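/- arXiv:math-ph/0610046 — 5 statements merged into one kernel-verified Lean document; each statement's English description precedes it below -/
import Mathlib

section
/- Let a > 0 and z be real numbers with a + 1 + z > 0. The double series χ(s) = ∑_{m=1}^∞ ∑_{n=1}^∞ (a m + n + z)^{-s} converges absolutely for Re(s) > 2, and every analytic continuation f of this series to the point 0 satisfies f(0) = 1/4 + a/12 + 1/(12a) + z²/(2a) + z/(2a) + z/2. -/
/-- `f` is an analytic continuation to `s₀` of the function `F` given (by an absolutely
convergent series) on the half-plane `{s : Re s > c}`: there is an open connected set `U`
containing `s₀` and the half-plane, on which `f` is analytic and agrees with `F` on the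
half-plane. -/
def IsContinuationAt (F : ℂ → ℂ) (c : ℝ) (s₀ : ℂ) (f : ℂ → ℂ) : Prop :=
  ∃ U : Set ℂ, IsOpen U ∧ IsConnected U ∧ s₀ ∈ U ∧ {s : ℂ | c < s.re} ⊆ U ∧
    AnalyticOnNhd ℂ f U ∧ ∀ s : ℂ, c < s.re → f s = F s

section Helpers

open Complex Set Filter Topology Asymptotics MeasureTheory

/-- The Mellin transform of `t ^ k * exp (-w t)`. -/
theorem hasMellin_pow_mul_exp {w : ℝ} (hw : 0 < w) (k : ℕ) {s : ℂ} (hs : 0 < s.re) :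
    HasMellin (fun t : ℝ => ((Real.exp (-w * t) * t ^ k : ℝ) : ℂ)) s
      (Gamma (s + k) * (w : ℂ) ^ (-(s + k))) := by
  have hsk : 0 < (s + k).re := by
    rw [add_re, natCast_re]; positivity
  have hint := integral_cpow_mul_exp_neg_mul_Ioi hsk hw
  constructor
  · refine mellinConvergent_of_isBigO_rpow_exp (a := w / 2) (b := 0) (half_pos hw) ?_ ?_ ?_ hs
    · exact (by fun_prop : Continuous _).continuousOn.locallyIntegrableOn measurableSet_Ioi
    · refine IsBigO.of_norm_left ?_
      simp only [norm_real]
      refine IsBigO.norm_left ?_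
      have h1 : (fun t : ℝ => t ^ k) =O[atTop] fun t => Real.exp (w / 2 * t) :=
        (isLittleO_pow_exp_pos_mul_atTop k (half_pos hw)).isBigO
      refine ((isBigO_refl (fun t : ℝ => Real.exp (-w * t)) atTop).mul h1).congr_right fun t => ?_
      rw [← Real.exp_add]; ring_nf
    · simp only [neg_zero, Real.rpow_zero]
      have hcont : Continuous fun t : ℝ => ((Real.exp (-w * t) * t ^ k : ℝ) : ℂ) := by fun_prop
      exact ((hcont.tendsto 0).isBigO_one ℝ).mono nhdsWithin_le_nhds
  · have hwarg : (w : ℂ).arg ≠ Real.pi := by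
      rw [arg_ofReal_of_nonneg hw.le]; exact Real.pi_pos.ne
    rw [cpow_neg, ← inv_cpow _ _ hwarg, mul_comm, inv_eq_one_div, ← hint, mellin]
    refine setIntegral_congr_fun measurableSet_Ioi fun t (ht : 0 < t) => ?_
    have ht' : (t : ℂ) ≠ 0 := ofReal_ne_zero.mpr ht.ne'
    have : s + k - 1 = (s - 1) + k := by ring
    simp only [smul_eq_mul, this, cpow_add _ _ ht', cpow_natCast]
    push_cast
    rw [neg_mul]; ring

theorem Gamma_add_natCast_eq_prod_mul {s : ℂ} (hs : 0 < s.re) (k : ℕ) :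
    Gamma (s + k) = (∏ j ∈ Finset.range k, (s + j)) * Gamma s := by
  induction k with
  | zero => simp
  | succ k ih =>
    have h0 : s + k ≠ 0 := fun h => by
      have := congrArg re h
      simp only [add_re, natCast_re, zero_re] at this
      linarith [(Nat.cast_nonneg k : (0 : ℝ) ≤ k)]
    rw [Nat.cast_succ, ← add_assoc, Gamma_add_one _ h0, ih, Finset.prod_range_succ]
    ring

section MellinContinuation

variable {H : ℝ → ℝ} {w : ℝ} {p N : ℕ} {c : ℕ → ℝ}

theorem mellinConvergent_and_differentiableAt_remainder (hw : 0 < w) (hc : ContinuousOn H (Ioi 0))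
    (htop : H =O[atTop] (fun t : ℝ => t ^ p))
    (h0 : (fun t => H t - ∑ k ∈ Finset.range N, c k * t ^ k) =O[𝓝[>] 0] (fun t : ℝ => t ^ N))
    {s : ℂ} (hs : -(N : ℝ) < s.re) :
    MellinConvergent
        (fun t => ((Real.exp (-w * t) * (H t - ∑ k ∈ Finset.range N, c k * t ^ k) : ℝ) : ℂ)) s ∧
      DifferentiableAt ℂ (mellin
        (fun t => ((Real.exp (-w * t) * (H t - ∑ k ∈ Finset.range N, c k * t ^ k) : ℝ) : ℂ))) s := by
  have hli : LocallyIntegrableOn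
      (fun t => ((Real.exp (-w * t) * (H t - ∑ k ∈ Finset.range N, c k * t ^ k) : ℝ) : ℂ))
      (Ioi 0) := by
    refine ContinuousOn.locallyIntegrableOn ?_ measurableSet_Ioi
    exact continuous_ofReal.comp_continuousOn
      ((by fun_prop : Continuous _).continuousOn.mul
        (hc.sub (by fun_prop : Continuous _).continuousOn))
  have htop' : (fun t => ((Real.exp (-w * t) * (H t - ∑ k ∈ Finset.range N, c k * t ^ k) : ℝ) : ℂ))
      =O[atTop] (fun t => Real.exp (-(w / 2) * t)) := by
    refine IsBigO.of_norm_left ?_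
    simp only [norm_real]
    refine IsBigO.norm_left ?_
    have hpow (k : ℕ) : (fun t : ℝ => t ^ k) =O[atTop] fun t => Real.exp (w / 2 * t) :=
      (isLittleO_pow_exp_pos_mul_atTop k (half_pos hw)).isBigO
    have h1 : (fun t => H t - ∑ k ∈ Finset.range N, c k * t ^ k) =O[atTop]
        fun t => Real.exp (w / 2 * t) :=
      (htop.trans (hpow p)).sub (IsBigO.fun_sum fun k _ => (hpow k).const_mul_left (c k))
    refine ((isBigO_refl (fun t : ℝ => Real.exp (-w * t)) atTop).mul h1).congr_right fun t => ?_
    rw [← Real.exp_add]; ring_nf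
  have hbot : (fun t => ((Real.exp (-w * t) * (H t - ∑ k ∈ Finset.range N, c k * t ^ k) : ℝ) : ℂ))
      =O[𝓝[>] 0] (fun t : ℝ => t ^ (-(-(N : ℝ)))) := by
    refine IsBigO.of_norm_left ?_
    simp only [norm_real, neg_neg, Real.rpow_natCast]
    refine IsBigO.norm_left ?_
    have hcont : Continuous fun t : ℝ => Real.exp (-w * t) := by fun_prop
    have h1 : (fun t : ℝ => Real.exp (-w * t)) =O[𝓝[>] 0] (fun _ => (1 : ℝ)) :=
      ((hcont.tendsto 0).isBigO_one ℝ).mono nhdsWithin_le_nhds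
    simpa using h1.mul h0
  exact ⟨mellinConvergent_of_isBigO_rpow_exp (half_pos hw) hli htop' hbot hs,
    mellin_differentiableAt_of_isBigO_rpow_exp (half_pos hw) hli htop' hbot hs⟩

/-- The continuation of `mellin (exp (-w t) H t) / Gamma` to `-N < re s`, given an expansion of
`H` of order `N` at `0`. -/
theorem exists_continuation_mellin_div_Gamma (hw : 0 < w) (hc : ContinuousOn H (Ioi 0))
    (htop : H =O[atTop] (fun t : ℝ => t ^ p))
    (h0 : (fun t => H t - ∑ k ∈ Finset.range N, c k * t ^ k) =O[𝓝[>] 0] (fun t : ℝ => t ^ N)) :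
    ∃ g : ℂ → ℂ, DifferentiableOn ℂ g {s | -(N : ℝ) < s.re} ∧
      (∀ s : ℂ, 0 < s.re →
        g s = (Gamma s)⁻¹ * mellin (fun t => ((Real.exp (-w * t) * H t : ℝ) : ℂ)) s) ∧
      ∀ n : ℕ, g (-n) = ∑ k ∈ Finset.range N,
        (c k : ℂ) * ((∏ j ∈ Finset.range k, (-(n : ℂ) + j)) * (w : ℂ) ^ (-(-(n : ℂ) + k))) := by
  have hw' : (w : ℂ) ≠ 0 := ofReal_ne_zero.mpr hw.ne'
  set R : ℝ → ℂ := fun t =>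
    ((Real.exp (-w * t) * (H t - ∑ k ∈ Finset.range N, c k * t ^ k) : ℝ) : ℂ) with hR
  refine ⟨fun s => (Gamma s)⁻¹ * mellin R s + ∑ k ∈ Finset.range N,
    (c k : ℂ) * ((∏ j ∈ Finset.range k, (s + j)) * (w : ℂ) ^ (-(s + k))), ?_, ?_, ?_⟩
  · intro s hs
    refine DifferentiableAt.differentiableWithinAt ?_
    refine ((differentiable_one_div_Gamma s).mul
      (mellinConvergent_and_differentiableAt_remainder hw hc htop h0 hs).2).add ?_
    refine DifferentiableAt.fun_sum fun k _ => DifferentiableAt.const_mul ?_ _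
    refine DifferentiableAt.mul ?_ ?_
    · exact DifferentiableAt.fun_finsetProd fun j _ => by fun_prop
    · exact DifferentiableAt.const_cpow (by fun_prop) (Or.inl hw')
  · intro s hs
    have hG : Gamma s ≠ 0 := Gamma_ne_zero_of_re_pos hs
    have hRs : MellinConvergent R s := (mellinConvergent_and_differentiableAt_remainder hw hc htop h0
      (lt_of_le_of_lt (neg_nonpos.mpr (Nat.cast_nonneg N)) hs)).1
    have hterm (k : ℕ) := hasMellin_pow_mul_exp hw k hs
    have hsplit : mellin (fun t => ((Real.exp (-w * t) * H t : ℝ) : ℂ)) s = mellin R s +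
        ∑ k ∈ Finset.range N, (c k : ℂ) * (Gamma (s + k) * (w : ℂ) ^ (-(s + k))) := by
      have : ∀ k ∈ Finset.range N, (c k : ℂ) * (Gamma (s + k) * (w : ℂ) ^ (-(s + k))) =
          ∫ t : ℝ in Ioi 0, (c k : ℂ) * ((t : ℂ) ^ (s - 1) •
            ((Real.exp (-w * t) * t ^ k : ℝ) : ℂ)) := fun k _ => by
        rw [integral_const_mul, ← (hterm k).2]; rfl
      have hi : ∀ k ∈ Finset.range N, IntegrableOn (fun t : ℝ => (c k : ℂ) * ((t : ℂ) ^ (s - 1) •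
            ((Real.exp (-w * t) * t ^ k : ℝ) : ℂ))) (Ioi 0) := fun k _ =>
        Integrable.const_mul (hterm k).1 _
      rw [Finset.sum_congr rfl this, ← integral_finsetSum _ hi, mellin, mellin,
        ← integral_add hRs (integrable_finsetSum _ hi)]
      congr 1
      funext t
      simp only [hR, smul_eq_mul]
      push_cast
      rw [mul_sub, mul_sub, Finset.mul_sum, Finset.mul_sum, sub_add, eq_comm, sub_eq_self,
        sub_eq_zero]
      exact Finset.sum_congr rfl fun k _ => by ring
    rw [hsplit, mul_add, Finset.mul_sum]
    refine congrArg₂ (· + ·) rfl (Finset.sum_congr rfl fun k _ => ?_)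
    rw [Gamma_add_natCast_eq_prod_mul hs k]
    field_simp
  · intro n
    simp [Gamma_neg_nat_eq_zero]

end MellinContinuation

/-- Functions on growing half-planes that agree on `0 < re s` glue to an entire function. -/
theorem exists_entire_of_continuations {F : ℂ → ℂ} (g : ℕ → ℂ → ℂ)
    (hd : ∀ N : ℕ, DifferentiableOn ℂ (g N) {s | -(N : ℝ) < s.re})
    (hg : ∀ N : ℕ, ∀ s : ℂ, 0 < s.re → g N s = F s) :
    ∃ G : ℂ → ℂ, Differentiable ℂ G ∧
      ∀ N : ℕ, ∀ s : ℂ, -(N : ℝ) < s.re → G s = g N s := by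
  have hopen (r : ℝ) : IsOpen {s : ℂ | r < s.re} := isOpen_lt continuous_const continuous_re
  have hle {M N : ℕ} (h : M ≤ N) {s : ℂ} (hs : -(M : ℝ) < s.re) : g N s = g M s := by
    have hsub : {s : ℂ | -(M : ℝ) < s.re} ⊆ {s | -(N : ℝ) < s.re} := fun s hs =>
      (neg_le_neg (Nat.cast_le.mpr h)).trans_lt (mem_ofPred_eq ▸ hs)
    refine AnalyticOnNhd.eqOn_of_preconnected_of_eventuallyEq (z₀ := 1)
      (((hd N).mono hsub).analyticOnNhd (hopen _)) ((hd M).analyticOnNhd (hopen _))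
      (convex_halfSpace_re_gt _).isPreconnected ?_ ?_ hs
    · simp only [mem_ofPred_eq, one_re]
      linarith [(Nat.cast_nonneg M : (0 : ℝ) ≤ M)]
    · filter_upwards [(hopen 0).mem_nhds (show (1 : ℂ) ∈ {s : ℂ | 0 < s.re} by simp)] with s hs
      rw [hg N s hs, hg M s hs]
  have hex (s : ℂ) : ∃ N : ℕ, -(N : ℝ) < s.re := by
    obtain ⟨N, hN⟩ := exists_nat_gt (-s.re)
    exact ⟨N, by linarith⟩
  choose n hn using hex
  have hG (N : ℕ) (s : ℂ) (hs : -(N : ℝ) < s.re) : g (n s) s = g N s := by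
    rcases le_total (n s) N with h | h
    · exact (hle h (hn s)).symm
    · exact hle h hs
  refine ⟨fun s => g (n s) s, fun s => ?_, hG⟩
  have hmem := (hopen (-(n s : ℝ))).mem_nhds (hn s)
  refine ((hd (n s)).differentiableAt hmem).congr_of_eventuallyEq ?_
  filter_upwards [hmem] with t ht using hG (n s) t ht

/-- The function `t / (1 - exp (-a t))`. -/
noncomputable def geomKernel (a t : ℝ) : ℝ := t / (1 - Real.exp (-a * t))

theorem one_sub_exp_neg_mul_pos {a t : ℝ} (ha : 0 < a) (ht : 0 < t) :
    0 < 1 - Real.exp (-a * t) := by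
  rw [sub_pos, Real.exp_lt_one_iff, neg_mul]
  exact neg_neg_of_pos (mul_pos ha ht)

theorem continuousOn_geomKernel {a : ℝ} (ha : 0 < a) : ContinuousOn (geomKernel a) (Ioi 0) := by
  refine continuousOn_id.div (by fun_prop) fun t ht => (one_sub_exp_neg_mul_pos ha ht).ne'

theorem isBigO_geomKernel_atTop {a : ℝ} (ha : 0 < a) :
    geomKernel a =O[atTop] (fun t : ℝ => t) := by
  have h1 : Tendsto (fun t : ℝ => Real.exp (-a * t)) atTop (𝓝 0) :=
    Real.tendsto_exp_atBot.comp (tendsto_id.const_mul_atTop_of_neg (neg_neg_of_pos ha))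
  have h2 : Tendsto (fun t : ℝ => (1 - Real.exp (-a * t))⁻¹) atTop (𝓝 (1 - 0)⁻¹) :=
    (tendsto_const_nhds.sub h1).inv₀ (by norm_num)
  exact ((isBigO_refl (fun t : ℝ => t) atTop).mul (h2.isBigO_one ℝ)).congr
    (fun t => (div_eq_mul_inv _ _).symm) (fun t => mul_one t)

theorem exists_analyticAt_eq_geomKernel {a : ℝ} (ha : a ≠ 0) :
    ∃ κ : ℝ → ℝ, AnalyticAt ℝ κ 0 ∧ (∀ t ≠ 0, κ t = geomKernel a t) := by
  set D : ℝ → ℝ := fun t => 1 - Real.exp (-a * t) with hD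
  have hDa : AnalyticAt ℝ D 0 := by fun_prop
  obtain ⟨p, hp⟩ := hDa
  have hder : HasDerivAt D a 0 := by
    have := ((hasDerivAt_id (0 : ℝ)).const_mul (-a)).exp.const_sub 1
    simpa [hD] using this
  refine ⟨fun t => (dslope D 0 t)⁻¹, (hp.has_fpower_series_dslope_fslope).analyticAt.fun_inv ?_,
    fun t ht => ?_⟩
  · rwa [dslope_same, hder.deriv]
  · beta_reduce
    rw [dslope_of_ne _ ht, slope_def_field, geomKernel]
    simp [hD]

theorem exists_isBigO_sub_sum_of_analyticAt {f : ℝ → ℝ} (hf : AnalyticAt ℝ f 0) (N : ℕ) :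
    ∃ c : ℕ → ℝ, (fun t => f t - ∑ k ∈ Finset.range N, c k * t ^ k) =O[𝓝 0] (fun t => t ^ N) := by
  obtain ⟨p, hp⟩ := hf
  refine ⟨p.coeff, IsBigO.of_norm_right ?_⟩
  simpa [FormalMultilinearSeries.partialSum, mul_comm] using hp.isBigO_sub_partialSum_pow N

theorem exists_isBigO_geomKernel_mul_sub_sum {a b : ℝ} (ha : a ≠ 0) (hb : b ≠ 0) (N : ℕ) :
    ∃ c : ℕ → ℝ, (fun t => geomKernel a t * geomKernel b t - ∑ k ∈ Finset.range N, c k * t ^ k)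
      =O[𝓝[>] 0] (fun t => t ^ N) := by
  obtain ⟨κ, hκ, hκa⟩ := exists_analyticAt_eq_geomKernel ha
  obtain ⟨μ, hμ, hμb⟩ := exists_analyticAt_eq_geomKernel hb
  obtain ⟨c, hc⟩ := exists_isBigO_sub_sum_of_analyticAt (hκ.fun_mul hμ) N
  refine ⟨c, (hc.mono nhdsWithin_le_nhds).congr' ?_ EventuallyEq.rfl⟩
  filter_upwards [self_mem_nhdsWithin] with t (ht : 0 < t)
  rw [hκa t ht.ne', hμb t ht.ne']

theorem isBigO_geomKernel_one {a : ℝ} (ha : a ≠ 0) :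
    geomKernel a =O[𝓝[>] 0] (fun _ => (1 : ℝ)) := by
  obtain ⟨κ, hκ, hκa⟩ := exists_analyticAt_eq_geomKernel ha
  refine ((hκ.continuousAt.isBigO_one ℝ).mono nhdsWithin_le_nhds).congr' ?_ EventuallyEq.rfl
  filter_upwards [self_mem_nhdsWithin] with t (ht : 0 < t) using hκa t ht.ne'

theorem isBigO_geomKernel_sub {a : ℝ} (ha : 0 < a) :
    (fun t => geomKernel a t - (1 / a + t / 2 + a * t ^ 2 / 12)) =O[𝓝[>] 0] (fun t => t ^ 3) := by
  have hexp : (fun t => Real.exp (-a * t) -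
      ∑ i ∈ Finset.range 4, (-a * t) ^ i / (i.factorial : ℝ)) =O[𝓝[>] 0] (fun t => t ^ 4) := by
    have h0 : Tendsto (fun t : ℝ => -a * t) (𝓝[>] 0) (𝓝 0) :=
      ((continuous_const_mul (-a)).tendsto' 0 0 (mul_zero _)).mono_left nhdsWithin_le_nhds
    refine ((Real.exp_sub_sum_range_isBigO_pow 4).comp_tendsto h0).trans ?_
    simp only [Function.comp_def, mul_pow]
    exact isBigO_const_mul_self _ _ _
  have hpoly {f : ℝ → ℝ} (hf : Continuous f) : f =O[𝓝[>] 0] (fun _ => (1 : ℝ)) :=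
    ((hf.tendsto 0).isBigO_one ℝ).mono nhdsWithin_le_nhds
  have hnum : (fun t => t - (1 - Real.exp (-a * t)) * (1 / a + t / 2 + a * t ^ 2 / 12))
      =O[𝓝[>] 0] (fun t => t ^ 4) := by
    have h1 := hexp.mul (hpoly (f := fun t => 1 / a + t / 2 + a * t ^ 2 / 12) (by fun_prop))
    have h2 := (isBigO_refl (fun t : ℝ => t ^ 4) (𝓝[>] 0)).mul
      (hpoly (f := fun t => -a ^ 3 / 24 - a ^ 4 * t / 72) (by fun_prop))
    refine (h1.add (by simpa using h2)).congr (fun t => ?_) (fun t => mul_one _)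
    simp only [Finset.sum_range_succ, Finset.sum_range_zero, Nat.factorial]
    field_simp
    push_cast
    ring
  have hinv : (fun t => (1 - Real.exp (-a * t))⁻¹) =O[𝓝[>] 0] (fun t => t⁻¹) := by
    refine ((isBigO_geomKernel_one ha.ne').mul (isBigO_refl (fun t : ℝ => t⁻¹) _)).congr' ?_
      (by simp)
    filter_upwards [self_mem_nhdsWithin] with t (ht : 0 < t)
    rw [geomKernel]
    field_simp
  refine (hnum.mul hinv).congr' ?_ ?_
  · filter_upwards [self_mem_nhdsWithin] with t (ht : 0 < t)
    rw [sub_mul, geomKernel, mul_right_comm,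
      mul_inv_cancel₀ (one_sub_exp_neg_mul_pos ha ht).ne', one_mul, ← div_eq_mul_inv]
  · filter_upwards [self_mem_nhdsWithin] with t (ht : 0 < t)
    field_simp

theorem isBigO_geomKernel_mul_sub {a b : ℝ} (ha : 0 < a) (hb : 0 < b) :
    (fun t => geomKernel a t * geomKernel b t - (1 / (a * b) + (1 / a + 1 / b) / 2 * t
      + (a / b + b / a + 3) / 12 * t ^ 2)) =O[𝓝[>] 0] (fun t => t ^ 3) := by
  have hpoly {f : ℝ → ℝ} (hf : Continuous f) : f =O[𝓝[>] 0] (fun _ => (1 : ℝ)) :=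
    ((hf.tendsto 0).isBigO_one ℝ).mono nhdsWithin_le_nhds
  have h1 := (isBigO_geomKernel_sub ha).mul (isBigO_geomKernel_one hb.ne')
  have h2 := (isBigO_geomKernel_sub hb).mul
    (hpoly (f := fun t => 1 / a + t / 2 + a * t ^ 2 / 12) (by fun_prop))
  have h3 := (isBigO_refl (fun t : ℝ => t ^ 3) (𝓝[>] 0)).mul
    (hpoly (f := fun t => (a + b) / 24 + a * b * t / 144) (by fun_prop))
  refine ((h1.add h2).add h3).congr (fun t => ?_) (fun t => mul_one _)
  field_simp
  ring

theorem hasSum_exp_neg_add_mul_add {a b w t : ℝ} (ha : 0 < a) (hb : 0 < b) (ht : 0 < t) :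
    HasSum (fun q : ℕ × ℕ => Real.exp (-(w + a * q.1 + b * q.2) * t))
      (Real.exp (-w * t) * ((1 - Real.exp (-a * t))⁻¹ * (1 - Real.exp (-b * t))⁻¹)) := by
  have hgeom {c : ℝ} (hc : 0 < c) :=
    hasSum_geometric_of_lt_one (Real.exp_pos (-c * t)).le
      (sub_pos.mp (one_sub_exp_neg_mul_pos hc ht))
  refine (((hgeom ha).mul (hgeom hb) ((hgeom ha).summable.mul_of_nonneg (hgeom hb).summable
    (fun n => (pow_pos (Real.exp_pos _) n).le) fun n => (pow_pos (Real.exp_pos _) n).le)).mul_left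
      (Real.exp (-w * t))).congr_fun fun q => ?_
  rw [← Real.exp_nat_mul, ← Real.exp_nat_mul, ← Real.exp_add, ← Real.exp_add]
  ring_nf

theorem summable_add_mul_add_rpow {a b w σ : ℝ} (ha : 0 < a) (hb : 0 < b) (hw : 0 < w)
    (hσ : 2 < σ) : Summable (fun q : ℕ × ℕ => (w + a * q.1 + b * q.2) ^ (-σ)) := by
  obtain ⟨c, hc, hcw, hca, hcb⟩ : ∃ c : ℝ, 0 < c ∧ 2 * c ≤ w ∧ c ≤ a ∧ c ≤ b :=
    ⟨min (w / 2) (min a b), by positivity, by linarith [min_le_left (w / 2) (min a b)],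
      (min_le_right _ _).trans (min_le_left _ _), (min_le_right _ _).trans (min_le_right _ _)⟩
  have h1 : Summable fun n : ℕ => ((n : ℝ) + 1) ^ (-(σ / 2)) := by
    have := (Real.summable_nat_rpow (p := -(σ / 2))).mpr (by linarith)
    simpa using (summable_nat_add_iff 1).mpr this
  have h2 := (h1.mul_of_nonneg h1 (fun n => by positivity) fun n => by positivity).mul_left
    (c ^ (-σ))
  refine h2.of_nonneg_of_le (fun q => by positivity) fun q => ?_
  obtain ⟨m, n⟩ := q
  have hm : (0 : ℝ) < m + 1 := by positivity
  have hn : (0 : ℝ) < n + 1 := by positivity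
  have hm0 : (0 : ℝ) ≤ m := by positivity
  have hn0 : (0 : ℝ) ≤ n := by positivity
  have hsq (x : ℝ) (hx : 0 < x) : x ^ (-(σ / 2)) = (√x) ^ (-σ) := by
    rw [Real.sqrt_eq_rpow, ← Real.rpow_mul hx.le]; ring_nf
  simp only
  rw [hsq _ hm, hsq _ hn, ← Real.mul_rpow (by positivity) (by positivity),
    ← Real.mul_rpow hc.le (by positivity)]
  refine Real.rpow_le_rpow_of_nonpos (by positivity) ?_ (by linarith)
  have h3 : √((m : ℝ) + 1) * √((n : ℝ) + 1) ≤ (m + 1) + (n + 1) := by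
    nlinarith [sq_nonneg (√((m : ℝ) + 1) - √((n : ℝ) + 1)), Real.sq_sqrt hm.le, Real.sq_sqrt hn.le]
  calc c * (√((m : ℝ) + 1) * √((n : ℝ) + 1)) ≤ c * ((m + 1) + (n + 1)) := by gcongr
    _ = 2 * c + c * m + c * n := by ring
    _ ≤ w + a * m + b * n := by gcongr

theorem mellin_geomKernel_mul_eq_tsum {a b w : ℝ} (ha : 0 < a) (hb : 0 < b) (hw : 0 < w) {s : ℂ}
    (hs : 2 < s.re) :
    mellin (fun t => ((Real.exp (-w * t) * (geomKernel a t * geomKernel b t) : ℝ) : ℂ)) (s - 2) =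
      Gamma s * ∑' q : ℕ × ℕ, ((w + a * q.1 + b * q.2 : ℝ) : ℂ) ^ (-s) := by
  have hpos (q : ℕ × ℕ) : 0 < w + a * q.1 + b * q.2 := by positivity
  have hsum := hasSum_mellin (a := fun _ : ℕ × ℕ => 1) (p := fun q => w + a * q.1 + b * q.2)
    (F := fun t => ((Real.exp (-w * t) *
      ((1 - Real.exp (-a * t))⁻¹ * (1 - Real.exp (-b * t))⁻¹) : ℝ) : ℂ)) (s := s)
    (fun q => Or.inr (hpos q)) (by linarith)
    (fun t ht => by
      simpa only [one_mul] using hasSum_ofReal.mpr (hasSum_exp_neg_add_mul_add ha hb ht))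
    (by simpa [← Real.rpow_neg (hpos _).le] using summable_add_mul_add_rpow ha hb hw hs)
  rw [← tsum_mul_left]
  simp only [mul_one, div_eq_mul_inv, ← cpow_neg] at hsum
  rw [hsum.tsum_eq, mellin, mellin]
  refine setIntegral_congr_fun measurableSet_Ioi fun t (ht : 0 < t) => ?_
  have ht' : (t : ℂ) ≠ 0 := ofReal_ne_zero.mpr ht.ne'
  have : s - 1 = (s - 2 - 1) + (2 : ℕ) := by push_cast; ring
  simp only [smul_eq_mul, this, cpow_add _ _ ht', cpow_natCast, geomKernel]
  push_cast
  ring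

theorem exists_entire_eq_mellin_geomKernel {a b w : ℝ} (ha : 0 < a) (hb : 0 < b) (hw : 0 < w) :
    ∃ G : ℂ → ℂ, Differentiable ℂ G ∧
      (∀ s : ℂ, 0 < s.re → G s = (Gamma s)⁻¹ *
        mellin (fun t => ((Real.exp (-w * t) * (geomKernel a t * geomKernel b t) : ℝ) : ℂ)) s) ∧
      G (-2) = ((w ^ 2 / (a * b) - (1 / a + 1 / b) * w + (a / b + b / a + 3) / 6 : ℝ) : ℂ) := by
  have hcont : ContinuousOn (fun t => geomKernel a t * geomKernel b t) (Ioi 0) :=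
    (continuousOn_geomKernel ha).mul (continuousOn_geomKernel hb)
  have htop : (fun t => geomKernel a t * geomKernel b t) =O[atTop] (fun t : ℝ => t ^ 2) := by
    simpa only [sq] using (isBigO_geomKernel_atTop ha).mul (isBigO_geomKernel_atTop hb)
  choose c hc using exists_isBigO_geomKernel_mul_sub_sum ha.ne' hb.ne'
  choose g hgd hg _ using fun N => exists_continuation_mellin_div_Gamma hw hcont htop (hc N)
  let d : ℕ → ℝ := fun k =>
    if k = 0 then 1 / (a * b) else if k = 1 then (1 / a + 1 / b) / 2 else (a / b + b / a + 3) / 12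
  have hd : (fun t => geomKernel a t * geomKernel b t - ∑ k ∈ Finset.range 3, d k * t ^ k)
      =O[𝓝[>] 0] (fun t : ℝ => t ^ 3) := by
    simpa [Finset.sum_range_succ, d] using isBigO_geomKernel_mul_sub ha hb
  obtain ⟨g₃, hgd₃, hg₃, hval⟩ := exists_continuation_mellin_div_Gamma hw hcont htop hd
  obtain ⟨G, hGd, hG⟩ := exists_entire_of_continuations (Function.update g 3 g₃)
    (F := fun s => (Gamma s)⁻¹ *
      mellin (fun t => ((Real.exp (-w * t) * (geomKernel a t * geomKernel b t) : ℝ) : ℂ)) s)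
    (fun N => by
      rcases eq_or_ne N 3 with rfl | h
      · simpa using hgd₃
      · simpa [h] using hgd N)
    (fun N s hs => by
      rcases eq_or_ne N 3 with rfl | h
      · simpa using hg₃ s hs
      · simpa [h] using hg N s hs)
  refine ⟨G, hGd, fun s hs => ?_, ?_⟩
  · rw [hG 0 s (by simpa using hs), Function.update_of_ne (by norm_num), hg 0 s hs]
  · have hw' : (w : ℂ) ≠ 0 := ofReal_ne_zero.mpr hw.ne'
    have h2 := hval 2
    have e0 : (w : ℂ) ^ (2 : ℂ) = (w : ℂ) ^ 2 := by exact_mod_cast cpow_natCast (w : ℂ) 2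
    have e1 : (-(-2 + 1) : ℂ) = 1 := by norm_num
    simp only [Finset.sum_range_succ, Finset.sum_range_zero, Finset.prod_range_succ,
      Finset.prod_range_zero, d] at h2
    rw [hG 3 (-2) (by norm_num), Function.update_self]
    push_cast at h2
    rw [h2]
    simp [e1, e0]
    ring

end Helpers

/-- for `a > 0`, `a + 1 + z > 0`, the double series
`χ(s) = ∑_{m,n≥1} (am+n+z)^{-s}` converges absolutely for `Re s > 2`, and every analytic
continuation `f` of it to `0` satisfies
`f(0) = 1/4 + a/12 + 1/(12a) + z²/(2a) + z/(2a) + z/2`. -/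
theorem stmt4 (a z : ℝ) (ha : 0 < a) (hz : 0 < a + 1 + z) :
    (∀ s : ℂ, 2 < s.re →
      Summable (fun p : ℕ × ℕ =>
        ‖((a : ℂ) * (p.1 + 1) + ((p.2 : ℂ) + 1) + (z : ℂ)) ^ (-s)‖)) ∧
    ∀ f : ℂ → ℂ,
      IsContinuationAt
        (fun s => ∑' (m : ℕ) (n : ℕ), ((a : ℂ) * (m + 1) + ((n : ℂ) + 1) + (z : ℂ)) ^ (-s))
        2 0 f →
      f 0 = 1 / 4 + (a : ℂ) / 12 + 1 / (12 * (a : ℂ))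
        + (z : ℂ) ^ 2 / (2 * (a : ℂ)) + (z : ℂ) / (2 * (a : ℂ)) + (z : ℂ) / 2 := by
  have hw : 0 < a + 1 + z := hz
  have hbase (q : ℕ × ℕ) : (a : ℂ) * (q.1 + 1) + ((q.2 : ℂ) + 1) + (z : ℂ) =
      ((a + 1 + z + a * q.1 + 1 * q.2 : ℝ) : ℂ) := by
    push_cast; ring
  have hpos (q : ℕ × ℕ) : 0 < a + 1 + z + a * q.1 + 1 * q.2 := by positivity
  have hsum (s : ℂ) (hs : 2 < s.re) : Summable (fun p : ℕ × ℕ =>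
      ‖((a : ℂ) * (p.1 + 1) + ((p.2 : ℂ) + 1) + (z : ℂ)) ^ (-s)‖) := by
    simp only [hbase, Complex.norm_cpow_eq_rpow_re_of_pos (hpos _), Complex.neg_re]
    exact summable_add_mul_add_rpow ha one_pos hw hs
  refine ⟨hsum, fun f ⟨U, hUo, hUc, h0, hU, hf, hfF⟩ => ?_⟩
  obtain ⟨G, hGd, hG, hG2⟩ := exists_entire_eq_mellin_geomKernel ha one_pos hw
  have hfG (s : ℂ) (hs : 2 < s.re) : (s - 1) * (s - 2) * f s = G (s - 2) := by
    have hs2 : 0 < (s - 2).re := by simpa using hs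
    have hΓ : Complex.Gamma (s - 2) ≠ 0 := Complex.Gamma_ne_zero_of_re_pos hs2
    have hΓs : Complex.Gamma s = (s - 1) * (s - 2) * Complex.Gamma (s - 2) := by
      have := Gamma_add_natCast_eq_prod_mul hs2 2
      simp only [Finset.prod_range_succ, Finset.prod_range_zero] at this
      push_cast at this
      rw [sub_add_cancel] at this
      rw [this]; ring
    have hf' : f s = ∑' q : ℕ × ℕ, ((a + 1 + z + a * q.1 + 1 * q.2 : ℝ) : ℂ) ^ (-s) := by
      rw [hfF s hs]
      simp only [← hbase]
      exact ((hsum s hs).of_norm.tsum_prod).symm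
    rw [hG _ hs2, mellin_geomKernel_mul_eq_tsum ha one_pos hw hs, hf', hΓs]
    field_simp
  have hopen : IsOpen {s : ℂ | 2 < s.re} := isOpen_lt continuous_const Complex.continuous_re
  have key : (0 - 1) * (0 - 2) * f 0 = G (0 - 2) := by
    refine AnalyticOnNhd.eqOn_of_preconnected_of_eventuallyEq (z₀ := 3)
      (f := fun s => (s - 1) * (s - 2) * f s) (g := fun s => G (s - 2)) (U := U)
      (fun s hs => AnalyticAt.fun_mul (by fun_prop) (hf s hs))
      (fun s _ => (hGd.comp (differentiable_id.sub_const 2)).analyticAt s)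
      hUc.isPreconnected (hU (by norm_num : (2 : ℝ) < (3 : ℂ).re)) ?_ h0
    filter_upwards [hopen.mem_nhds (by norm_num : (2 : ℝ) < (3 : ℂ).re)] with s hs using hfG s hs
  have ha' : (a : ℂ) ≠ 0 := Complex.ofReal_ne_zero.mpr ha.ne'
  rw [zero_sub, zero_sub, hG2] at key
  have h2 : f 0 = (((a + 1 + z) ^ 2 / (a * 1) - (1 / a + 1 / 1) * (a + 1 + z)
      + (a / 1 + 1 / a + 3) / 6 : ℝ) : ℂ) / 2 := by
    rw [← key]; ring
  rw [h2]
  push_cast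
  field_simp
  ring
end

section
/- Let a > 0 and z be real numbers with a + 1 + z > 0, and let χ(s) = ∑_{m=1}^∞ ∑_{n=1}^∞ (a m + n + z)^{-s}, which converges absolutely for Re(s) > 2. For every open connected set U ⊆ ℂ with 2 ∈ U and {s : Re s > 2} ⊆ U, and every function f analytic on U ∖ {2} with f(s) = χ(s) whenever Re(s) > 2, one has lim_{s→2} (s−2)·f(s) = 1/a; that is, the analytic continuation of χ has at most a simple pole at s = 2 with residue 1/a. -/
open Filter

/-- `-cpowPrimitive s` is a primitive of `x ↦ x ^ (-s)` on the positive reals. -/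
noncomputable def cpowPrimitive (s : ℂ) (x : ℝ) : ℂ := (x : ℂ) ^ (1 - s) / (s - 1)

/-- `-cpowPrimitive₂ s` is a primitive of `cpowPrimitive s` on the positive reals. -/
noncomputable def cpowPrimitive₂ (s : ℂ) (x : ℝ) : ℂ := (x : ℂ) ^ (2 - s) / ((s - 1) * (s - 2))

/-- The mixed second difference of `cpowPrimitive₂ s` with steps `a` and `1`, divided by `a`; it is
the average of `x ^ (-s)` over `x + [0, a] + [0, 1]`. -/
noncomputable def cpowAverage (a : ℝ) (s : ℂ) (x : ℝ) : ℂ :=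
  ((cpowPrimitive₂ s x - cpowPrimitive₂ s (x + 1)) -
    (cpowPrimitive₂ s (x + a) - cpowPrimitive₂ s (x + a + 1))) / a

theorem hasDerivAt_cpowPrimitive {s : ℂ} (hs : s ≠ 1) {x : ℝ} (hx : 0 < x) :
    HasDerivAt (cpowPrimitive s) (-(x : ℂ) ^ (-s)) x := by
  have h1 : s - 1 ≠ 0 := sub_ne_zero.2 hs
  have h2 : 1 - s ≠ 0 := sub_ne_zero.2 hs.symm
  have h := (hasDerivAt_ofReal_cpow_const hx.ne' h2).div_const (s - 1)
  refine h.congr_deriv ?_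
  rw [show 1 - s - 1 = -s by ring]
  field_simp
  ring

theorem hasDerivAt_cpowPrimitive₂ {s : ℂ} (hs : s ≠ 2) {x : ℝ} (hx : 0 < x) :
    HasDerivAt (cpowPrimitive₂ s) (-cpowPrimitive s x) x := by
  have h1 : s - 2 ≠ 0 := sub_ne_zero.2 hs
  have h2 : 2 - s ≠ 0 := sub_ne_zero.2 hs.symm
  have h := (hasDerivAt_ofReal_cpow_const hx.ne' h2).div_const ((s - 1) * (s - 2))
  refine h.congr_deriv ?_
  rw [show 2 - s - 1 = 1 - s by ring, cpowPrimitive, mul_comm (s - 1),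
    ← neg_sub s 2, neg_mul, neg_div, mul_div_mul_left _ _ h1]

theorem norm_cpow_neg_sub_le {s : ℂ} (hs : 0 < s.re) {x y : ℝ} (hx : 0 < x) (hxy : x ≤ y) :
    ‖(y : ℂ) ^ (-s) - (x : ℂ) ^ (-s)‖ ≤ ‖s‖ * x ^ (-s.re - 1) * (y - x) := by
  have hs0 : -s ≠ 0 := by
    rintro h
    simp [neg_eq_zero.1 h] at hs
  refine norm_image_sub_le_of_norm_deriv_le_segment' (f := fun t : ℝ => (t : ℂ) ^ (-s))
    (fun t ht => (hasDerivAt_ofReal_cpow_const (hx.trans_le ht.1).ne' hs0).hasDerivWithinAt)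
    (fun t ht => ?_) y ⟨hxy, le_rfl⟩
  rw [norm_mul, norm_neg, Complex.norm_cpow_eq_rpow_re_of_pos (hx.trans_le ht.1)]
  gcongr
  simpa using Real.rpow_le_rpow_of_nonpos hx ht.1 (by linarith : -s.re - 1 ≤ 0)

theorem norm_cpowPrimitive_sub_sub_cpow_le {s : ℂ} (hs : 0 < s.re) (hs1 : s ≠ 1) {x : ℝ}
    (hx : 0 < x) :
    ‖cpowPrimitive s x - cpowPrimitive s (x + 1) - (x : ℂ) ^ (-s)‖ ≤
      ‖s‖ * x ^ (-s.re - 1) := by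
  have h := norm_image_sub_le_of_norm_deriv_le_segment' (a := x) (b := x + 1)
    (f := fun t : ℝ => cpowPrimitive s t + t * (x : ℂ) ^ (-s))
    (f' := fun t => -(t : ℂ) ^ (-s) + 1 * (x : ℂ) ^ (-s)) (C := ‖s‖ * x ^ (-s.re - 1))
    (fun t ht => ((hasDerivAt_cpowPrimitive hs1 (hx.trans_le ht.1)).add
      ((hasDerivAt_id t).ofReal_comp.mul_const _)).hasDerivWithinAt)
    (fun t ht => ?_) (x + 1) ⟨by linarith, le_rfl⟩
  · rw [← norm_neg]
    convert h using 1
    · congr 1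
      push_cast
      ring
    · ring
  · rw [← norm_neg, one_mul, neg_add, neg_neg, ← sub_eq_add_neg]
    refine (norm_cpow_neg_sub_le hs hx ht.1).trans (mul_le_of_le_one_right (by positivity) ?_)
    linarith [ht.2]

theorem norm_cpowPrimitive_sub_sub_le {s : ℂ} (hs : 0 < s.re) (hs1 : s ≠ 1) {x y : ℝ}
    (hx : 0 < x) (hxy : x ≤ y) :
    ‖(cpowPrimitive s y - cpowPrimitive s (y + 1)) -
      (cpowPrimitive s x - cpowPrimitive s (x + 1))‖ ≤ ‖s‖ * x ^ (-s.re - 1) * (y - x) := by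
  refine norm_image_sub_le_of_norm_deriv_le_segment'
    (f := fun t : ℝ => cpowPrimitive s t - cpowPrimitive s (t + 1))
    (fun t ht => ((hasDerivAt_cpowPrimitive hs1 (hx.trans_le ht.1)).sub
      ((hasDerivAt_cpowPrimitive hs1 (x := t + 1)
        (by linarith [ht.1])).comp_add_const t 1)).hasDerivWithinAt)
    (fun t ht => ?_) y ⟨hxy, le_rfl⟩
  have ht0 : 0 < t := hx.trans_le ht.1
  rw [neg_sub_neg]
  refine (norm_cpow_neg_sub_le hs ht0 (by linarith : t ≤ t + 1)).trans ?_
  rw [add_sub_cancel_left, mul_one]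
  gcongr ?_ * ?_
  exact Real.rpow_le_rpow_of_nonpos hx ht.1 (by linarith)

theorem norm_cpowAverage_sub_cpow_le {a : ℝ} (ha : 0 < a) {s : ℂ} (hs : 0 < s.re) (hs1 : s ≠ 1)
    (hs2 : s ≠ 2) {x : ℝ} (hx : 0 < x) :
    ‖(x : ℂ) ^ (-s) - cpowAverage a s x‖ ≤ ‖s‖ * x ^ (-s.re - 1) * (a + 1) := by
  set K := cpowPrimitive s x - cpowPrimitive s (x + 1) with hK
  have hK' : ‖K - (x : ℂ) ^ (-s)‖ ≤ ‖s‖ * x ^ (-s.re - 1) :=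
    norm_cpowPrimitive_sub_sub_cpow_le hs hs1 hx
  have h := norm_image_sub_le_of_norm_deriv_le_segment' (a := x) (b := x + a)
    (f := fun t : ℝ => cpowPrimitive₂ s t - cpowPrimitive₂ s (t + 1) + t * K)
    (f' := fun t => -cpowPrimitive s t - -cpowPrimitive s (t + 1) + 1 * K)
    (C := ‖s‖ * x ^ (-s.re - 1) * a)
    (fun t ht => (((hasDerivAt_cpowPrimitive₂ hs2 (hx.trans_le ht.1)).sub
      ((hasDerivAt_cpowPrimitive₂ hs2 (x := t + 1)
        (by linarith [ht.1])).comp_add_const t 1)).add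
      ((hasDerivAt_id t).ofReal_comp.mul_const _)).hasDerivWithinAt)
    (fun t ht => ?_) (x + a) ⟨by linarith, le_rfl⟩
  · have ha' : (a : ℂ) ≠ 0 := mod_cast ha.ne'
    have hA : ‖cpowAverage a s x - K‖ ≤ ‖s‖ * x ^ (-s.re - 1) * a := by
      rw [← mul_le_mul_iff_left₀ ha, ← norm_neg]
      calc ‖-(cpowAverage a s x - K)‖ * a = ‖-(cpowAverage a s x - K) * a‖ := by
            rw [norm_mul, Complex.norm_of_nonneg ha.le]
        _ ≤ _ := by
            convert h using 1
            · congr 1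
              rw [cpowAverage]
              push_cast
              field_simp
              ring
            · ring
    calc ‖(x : ℂ) ^ (-s) - cpowAverage a s x‖
        = ‖(cpowAverage a s x - K) + (K - (x : ℂ) ^ (-s))‖ := by
          rw [← norm_neg]
          congr 1
          ring
      _ ≤ _ := (norm_add_le _ _).trans (by linarith)
  · rw [← norm_neg]
    calc _ = ‖(cpowPrimitive s t - cpowPrimitive s (t + 1)) - K‖ := by
          congr 1
          ring
      _ ≤ ‖s‖ * x ^ (-s.re - 1) * (t - x) := norm_cpowPrimitive_sub_sub_le hs hs1 hx ht.1
      _ ≤ _ := by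
          gcongr
          linarith [ht.2]

theorem summable_lattice_rpow {a c : ℝ} (ha : 0 < a) (hc : 0 < c) {p : ℝ} (hp : 2 < p) :
    Summable (fun q : ℕ × ℕ => (c + a * q.1 + q.2) ^ (-p)) := by
  obtain ⟨k, hk, hkc, hka, hk1⟩ : ∃ k : ℝ, 0 < k ∧ k ≤ c / 2 ∧ k ≤ a ∧ k ≤ 1 :=
    ⟨min (c / 2) (min a 1), by positivity, min_le_left _ _,
      (min_le_right _ _).trans (min_le_left _ _), (min_le_right _ _).trans (min_le_right _ _)⟩
  have h1 : Summable (fun n : ℕ => ((n : ℝ) + 1) ^ (-(p / 2))) := by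
    have := (summable_nat_add_iff 1).2 (Real.summable_nat_rpow.2 (by linarith : -(p / 2) < -1))
    simpa using this
  have h2 := (h1.mul_of_nonneg h1 (fun n => by positivity) (fun n => by positivity)).mul_left
    (k ^ (-p))
  refine Summable.of_nonneg_of_le (fun q => by positivity) (fun q => ?_) h2
  obtain ⟨m, n⟩ := q
  have hm : (0 : ℝ) ≤ m := m.cast_nonneg
  have hn : (0 : ℝ) ≤ n := n.cast_nonneg
  have hsq : (((m : ℝ) + 1) * (n + 1)) = (√(((m : ℝ) + 1) * (n + 1))) ^ (2 : ℝ) := by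
    rw [Real.rpow_two, Real.sq_sqrt (by positivity)]
  rw [← Real.mul_rpow (by positivity) (by positivity), hsq, ← Real.rpow_mul (by positivity),
    show 2 * -(p / 2) = -p by ring, ← Real.mul_rpow (by positivity) (by positivity)]
  refine Real.rpow_le_rpow_of_nonpos (by positivity) ?_ (by linarith)
  have hsqrt : √(((m : ℝ) + 1) * (n + 1)) ≤ m + 1 + (n + 1) :=
    Real.sqrt_le_iff.2 ⟨by positivity, by nlinarith [mul_nonneg hm hn]⟩
  calc k * √(((m : ℝ) + 1) * (n + 1)) ≤ k * (m + 1 + (n + 1)) := by gcongr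
    _ ≤ c + a * m + n := by nlinarith

theorem HasSum.eq_of_telescoping {u f : ℕ → ℂ} {S : ℂ} (hf : HasSum f S)
    (hu : Tendsto u atTop (nhds 0)) (h : ∀ n, f n = u n - u (n + 1)) : S = u 0 := by
  have h1 := hf.tendsto_sum_nat
  simp only [h, Finset.sum_range_sub'] at h1
  simpa using tendsto_nhds_unique h1 (tendsto_const_nhds.sub hu)

theorem tendsto_cpowPrimitive₂_atTop {s : ℂ} (hs : 2 < s.re) :
    Tendsto (cpowPrimitive₂ s) atTop (nhds 0) := by
  have h : Tendsto (fun x : ℝ => (x : ℂ) ^ (2 - s)) atTop (nhds 0) := by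
    rw [tendsto_zero_iff_norm_tendsto_zero]
    refine (tendsto_rpow_neg_atTop (by linarith : 0 < s.re - 2)).congr' ?_
    filter_upwards [eventually_gt_atTop 0] with x hx
    rw [Complex.norm_cpow_eq_rpow_re_of_pos hx]
    simp
  rw [← zero_div ((s - 1) * (s - 2))]
  exact h.div_const _

theorem tsum_cpowAverage {a c : ℝ} (ha : 0 < a) {s : ℂ} (hs : 2 < s.re)
    (hsum : Summable (fun q : ℕ × ℕ => cpowAverage a s (c + a * q.1 + q.2))) :
    ∑' q : ℕ × ℕ, cpowAverage a s (c + a * q.1 + q.2) = cpowPrimitive₂ s c / a := by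
  have hG := tendsto_cpowPrimitive₂_atTop hs
  have hcast := tendsto_natCast_atTop_atTop (R := ℝ)
  have inner (m : ℕ) : ∑' n : ℕ, cpowAverage a s (c + a * m + n) =
      cpowPrimitive₂ s (c + a * m) / a - cpowPrimitive₂ s (c + a * (m + 1 : ℕ)) / a := by
    have h := (hsum.prod_factor m).hasSum.eq_of_telescoping
      (u := fun n : ℕ => cpowPrimitive₂ s (c + a * m + n) / a -
        cpowPrimitive₂ s (c + a * m + a + n) / a) ?_ (fun n => ?_)
    · rw [h]
      simp only [Nat.cast_zero, add_zero, Nat.cast_add, Nat.cast_one, mul_add, mul_one, add_assoc]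
    · simpa using ((hG.comp (tendsto_atTop_add_const_left _ (c + a * m) hcast)).div_const
        (a : ℂ)).sub ((hG.comp (tendsto_atTop_add_const_left _ (c + a * m + a) hcast)).div_const
        (a : ℂ))
    · rw [cpowAverage]
      push_cast
      rw [add_right_comm (c + a * m) (n : ℝ) a, ← add_assoc (c + a * m) (n : ℝ) 1,
        ← add_assoc (c + a * m + a) (n : ℝ) 1]
      ring
  rw [hsum.tsum_prod]
  have h := hsum.prod.hasSum.eq_of_telescoping
    (u := fun m : ℕ => cpowPrimitive₂ s (c + a * m) / a) ?_ inner
  · simpa using h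
  · simpa using (hG.comp (tendsto_atTop_add_const_left _ c
      (hcast.const_mul_atTop ha))).div_const (a : ℂ)

theorem isPreconnected_ball_diff_center (w : ℂ) {r : ℝ} (hr : 0 < r) :
    IsPreconnected (Metric.ball w r \ {w}) := by
  have h : Metric.ball w r \ {w} =
      (fun t : ℂ => w + Complex.exp t) '' {t : ℂ | t.re < Real.log r} := by
    ext v
    simp only [Set.mem_sdiff, mem_ball_iff_norm, Set.mem_singleton_iff, Set.mem_image,
      Set.mem_ofPred_eq]
    constructor
    · rintro ⟨hv, hne⟩
      have hne' := sub_ne_zero.2 hne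
      refine ⟨Complex.log (v - w), ?_, ?_⟩
      · rw [Complex.log_re]
        exact Real.log_lt_log (norm_pos_iff.2 hne') hv
      · rw [Complex.exp_log hne']
        ring
    · rintro ⟨t, ht, rfl⟩
      rw [add_sub_cancel_left, Complex.norm_exp]
      exact ⟨(Real.lt_log_iff_exp_lt hr).1 ht, by simp⟩
  rw [h]
  exact (convex_halfSpace_re_lt _).isPreconnected.image _ (by fun_prop)

theorem re_norm_bounds_of_mem_ball {s : ℂ} (hs : s ∈ Metric.ball (2 : ℂ) (1 / 2)) :
    3 / 2 < s.re ∧ s.re < 5 / 2 ∧ ‖s‖ ≤ 5 / 2 := by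
  rw [mem_ball_iff_norm] at hs
  have h1 := abs_lt.1 ((Complex.abs_re_le_norm (s - 2)).trans_lt hs)
  simp only [Complex.sub_re, Complex.re_ofNat] at h1
  refine ⟨by linarith, by linarith, ?_⟩
  calc ‖s‖ = ‖(s - 2) + 2‖ := by rw [sub_add_cancel]
    _ ≤ ‖s - 2‖ + ‖(2 : ℂ)‖ := norm_add_le _ _
    _ ≤ 5 / 2 := by
      rw [Complex.norm_ofNat]
      linarith

theorem norm_cpow_sub_cpowAverage_le_of_mem_ball {a : ℝ} (ha : 0 < a) {s : ℂ}
    (hs : s ∈ Metric.ball (2 : ℂ) (1 / 2) \ {2}) {x : ℝ} (hx : 0 < x) :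
    ‖(x : ℂ) ^ (-s) - cpowAverage a s x‖ ≤
      5 / 2 * (a + 1) * (x ^ (-(5 / 2 : ℝ)) + x ^ (-(7 / 2 : ℝ))) := by
  obtain ⟨h1, h2, h3⟩ := re_norm_bounds_of_mem_ball hs.1
  have hs1 : s ≠ 1 := by
    rintro rfl
    norm_num at h1
  have hpow : x ^ (-s.re - 1) ≤ x ^ (-(5 / 2 : ℝ)) + x ^ (-(7 / 2 : ℝ)) := by
    have p1 := Real.rpow_nonneg hx.le (-(5 / 2 : ℝ))
    have p2 := Real.rpow_nonneg hx.le (-(7 / 2 : ℝ))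
    rcases le_total 1 x with h | h
    · linarith [Real.rpow_le_rpow_of_exponent_le h (by linarith : -s.re - 1 ≤ -(5 / 2 : ℝ))]
    · linarith [Real.rpow_le_rpow_of_exponent_ge hx h (by linarith : -(7 / 2 : ℝ) ≤ -s.re - 1)]
  calc _ ≤ ‖s‖ * x ^ (-s.re - 1) * (a + 1) :=
        norm_cpowAverage_sub_cpow_le ha (by linarith) hs1 hs.2 hx
    _ ≤ 5 / 2 * (x ^ (-(5 / 2 : ℝ)) + x ^ (-(7 / 2 : ℝ))) * (a + 1) := by gcongr
    _ = _ := by ring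

theorem differentiableAt_cpowPrimitive₂ {x : ℝ} (hx : 0 < x) {s : ℂ} (hs1 : s ≠ 1) (hs2 : s ≠ 2) :
    DifferentiableAt ℂ (fun s => cpowPrimitive₂ s x) s := by
  have hx' : (x : ℂ) ≠ 0 := mod_cast hx.ne'
  exact ((differentiableAt_id.const_sub 2).const_cpow (Or.inl hx')).fun_div (by fun_prop)
    (mul_ne_zero (sub_ne_zero.2 hs1) (sub_ne_zero.2 hs2))

theorem differentiableAt_cpow_sub_cpowAverage {a : ℝ} (ha : 0 < a) {x : ℝ} (hx : 0 < x) {s : ℂ}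
    (hs1 : s ≠ 1) (hs2 : s ≠ 2) :
    DifferentiableAt ℂ (fun s => (x : ℂ) ^ (-s) - cpowAverage a s x) s := by
  have hx' : (x : ℂ) ≠ 0 := mod_cast hx.ne'
  have d {y : ℝ} (hy : 0 < y) := differentiableAt_cpowPrimitive₂ hy hs1 hs2
  exact (differentiableAt_id.neg.const_cpow (Or.inl hx')).sub
    ((((d hx).sub (d (by positivity))).sub
      ((d (by positivity)).sub (d (by positivity)))).div_const _)

/-- for `a > 0`, `a + 1 + z > 0`, the double series
`χ(s) = ∑_{m,n≥1} (am+n+z)^{-s}` converges absolutely for `Re s > 2`, and for every open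
connected `U` containing `2` and the half-plane `{Re s > 2}`, and every `f` analytic on
`U ∖ {2}` agreeing with the series on the half-plane, one has
`lim_{s→2} (s−2)·f(s) = 1/a`: the continuation has at most a simple pole at `2` with
residue `1/a`. -/
theorem stmt5 (a z : ℝ) (ha : 0 < a) (hz : 0 < a + 1 + z) :
    (∀ s : ℂ, 2 < s.re →
      Summable (fun p : ℕ × ℕ =>
        ‖((a : ℂ) * (p.1 + 1) + ((p.2 : ℂ) + 1) + (z : ℂ)) ^ (-s)‖)) ∧
    ∀ (U : Set ℂ) (f : ℂ → ℂ), IsOpen U → IsConnected U → (2 : ℂ) ∈ U →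
      {s : ℂ | 2 < s.re} ⊆ U → AnalyticOnNhd ℂ f (U \ {2}) →
      (∀ s : ℂ, 2 < s.re →
        f s = ∑' (m : ℕ) (n : ℕ), ((a : ℂ) * (m + 1) + ((n : ℂ) + 1) + (z : ℂ)) ^ (-s)) →
      Tendsto (fun s : ℂ => (s - 2) * f s) (nhdsWithin 2 {(2 : ℂ)}ᶜ)
        (nhds (1 / (a : ℂ))) := by
  set c : ℝ := a + 1 + z with hc
  have hx (q : ℕ × ℕ) : 0 < c + a * q.1 + q.2 := by positivity
  have hcast (m n : ℕ) : (a : ℂ) * (m + 1) + ((n : ℂ) + 1) + (z : ℂ) =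
      ((c + a * m + n : ℝ) : ℂ) := by
    push_cast [hc]
    ring
  simp only [hcast]
  have hsummable (s : ℂ) (hs : 2 < s.re) :
      Summable (fun q : ℕ × ℕ => ‖((c + a * q.1 + q.2 : ℝ) : ℂ) ^ (-s)‖) := by
    simp_rw [Complex.norm_cpow_eq_rpow_re_of_pos (hx _)]
    exact summable_lattice_rpow ha hz hs
  refine ⟨hsummable, fun U f hU _ h2U _ hf hfs => ?_⟩
  let F (q : ℕ × ℕ) (s : ℂ) : ℂ :=
    ((c + a * q.1 + q.2 : ℝ) : ℂ) ^ (-s) - cpowAverage a s (c + a * q.1 + q.2)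
  let u (q : ℕ × ℕ) : ℝ := 5 / 2 * (a + 1) *
    ((c + a * q.1 + q.2) ^ (-(5 / 2 : ℝ)) + (c + a * q.1 + q.2) ^ (-(7 / 2 : ℝ)))
  have hu : Summable u := ((summable_lattice_rpow ha hz (by norm_num)).add
    (summable_lattice_rpow ha hz (by norm_num))).mul_left _
  obtain ⟨ε, hε, hεU⟩ := Metric.isOpen_iff.1 hU 2 h2U
  set r := min ε (1 / 2) with hr
  have hr0 : 0 < r := by positivity
  set B := Metric.ball (2 : ℂ) r \ {2} with hB
  have hB_half {s : ℂ} (hs : s ∈ B) : s ∈ Metric.ball (2 : ℂ) (1 / 2) \ {2} :=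
    ⟨Metric.ball_subset_ball (min_le_right _ _) hs.1, hs.2⟩
  have hB_ne_one {s : ℂ} (hs : s ∈ B) : s ≠ 1 := by
    rintro rfl
    have := (re_norm_bounds_of_mem_ball (hB_half hs).1).1
    norm_num at this
  have hBopen : IsOpen B := Metric.isOpen_ball.sdiff isClosed_singleton
  have hFu (q : ℕ × ℕ) (s : ℂ) (hs : s ∈ B) : ‖F q s‖ ≤ u q :=
    norm_cpow_sub_cpowAverage_le_of_mem_ball ha (hB_half hs) (hx q)
  have hE : DifferentiableOn ℂ (fun s => ∑' q, F q s) B :=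
    Complex.differentiableOn_tsum_of_summable_norm hu
      (fun q s hs => (differentiableAt_cpow_sub_cpowAverage ha (hx q) (hB_ne_one hs)
        hs.2).differentiableWithinAt) hBopen hFu
  let g (s : ℂ) : ℂ := cpowPrimitive₂ s c / a + ∑' q, F q s
  have hg : DifferentiableOn ℂ g B :=
    fun s hs => ((differentiableAt_cpowPrimitive₂ hz (hB_ne_one hs)
      hs.2).div_const _).differentiableWithinAt.add (hE s hs)
  have hfg_half {s : ℂ} (hs : s ∈ B) (hs2 : 2 < s.re) : f s = g s := by
    have h1 := (hsummable s hs2).of_norm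
    have h2 : Summable (fun q => F q s) := hu.of_norm_bounded (fun q => hFu q s hs)
    have h3 : Summable (fun q : ℕ × ℕ => cpowAverage a s (c + a * q.1 + q.2)) :=
      (h1.sub h2).congr fun q => by simp [F]
    rw [hfs s hs2, ← h1.tsum_prod]
    simp only [g, F]
    rw [h1.tsum_sub h3, tsum_cpowAverage ha hs2 h3]
    ring
  have hfg : Set.EqOn f g B := by
    let w : ℂ := ((2 + r / 2 : ℝ) : ℂ)
    have hw : w ∈ B := by
      refine ⟨?_, ?_⟩
      · rw [mem_ball_iff_norm, show w - 2 = ((r / 2 : ℝ) : ℂ) by simp [w],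
          Complex.norm_of_nonneg (by positivity)]
        linarith
      · intro h
        have := congrArg Complex.re (Set.mem_singleton_iff.1 h)
        rw [Complex.ofReal_re, Complex.re_ofNat] at this
        linarith
    refine AnalyticOnNhd.eqOn_of_preconnected_of_eventuallyEq
      (hf.mono fun s hs => ⟨hεU (Metric.ball_subset_ball (min_le_left _ _) hs.1), hs.2⟩)
      (hg.analyticOnNhd hBopen) (isPreconnected_ball_diff_center 2 hr0) hw ?_
    have hre : ∀ᶠ s : ℂ in nhds w, 2 < s.re :=
      (isOpen_lt continuous_const Complex.continuous_re).mem_nhds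
        (by simp only [w, Set.mem_ofPred_eq, Complex.ofReal_re]; linarith)
    filter_upwards [hBopen.mem_nhds hw, hre] with s hs hs2 using hfg_half hs hs2
  have hBnhds : B ∈ nhdsWithin 2 {(2 : ℂ)}ᶜ :=
    sdiff_mem_nhdsWithin_compl (Metric.ball_mem_nhds _ hr0) _
  have hmain : Tendsto (fun s : ℂ => (c : ℂ) ^ (2 - s) / (s - 1) / a)
      (nhdsWithin 2 {(2 : ℂ)}ᶜ) (nhds (1 / (a : ℂ))) := by
    have hc' : (c : ℂ) ≠ 0 := mod_cast hz.ne'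
    have : ContinuousAt (fun s : ℂ => (c : ℂ) ^ (2 - s) / (s - 1) / a) 2 :=
      (((continuousAt_const.sub continuousAt_id).const_cpow (Or.inl hc')).div
        (by fun_prop) (by norm_num)).div_const _
    have h := this.tendsto.mono_left (nhdsWithin_le_nhds (s := {(2 : ℂ)}ᶜ))
    norm_num at h
    simpa using h
  have hrest : Tendsto (fun s : ℂ => (s - 2) * ∑' q, F q s)
      (nhdsWithin 2 {(2 : ℂ)}ᶜ) (nhds 0) := by
    refine Tendsto.zero_mul_isBoundedUnder_le ?_ ?_
    · have : ContinuousAt (fun s : ℂ => s - 2) 2 := by fun_prop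
      simpa using this.tendsto.mono_left (nhdsWithin_le_nhds (s := {(2 : ℂ)}ᶜ))
    · refine isBoundedUnder_of_eventually_le (a := ∑' q, u q) ?_
      filter_upwards [hBnhds] with s hs
      exact tsum_of_norm_bounded hu.hasSum fun q => hFu q s hs
  refine ((add_zero (1 / (a : ℂ))) ▸ hmain.add hrest).congr' ?_
  filter_upwards [hBnhds] with s hs
  have h2 : s - 2 ≠ 0 := sub_ne_zero.2 hs.2
  rw [hfg hs]
  simp only [g, cpowPrimitive₂, mul_add]
  congr 1
  rw [mul_div_assoc', mul_div_assoc', mul_comm (s - 1), mul_div_mul_left _ _ h2]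
end

section
/- The series Z(s) = ∑_{n=1}^∞ (n(n+1))^{-s} converges absolutely for Re(s) > 1, and every analytic continuation f of this series to the point 0 satisfies f(0) = −1 and f'(0) = −log(2π). -/
open Filter Topology

lemma multichoose_eq_prod_div_factorial (s : ℂ) (k : ℕ) :
    Ring.multichoose s k = (∏ i ∈ Finset.range k, (s + i)) / k.factorial := by
  have h := Ring.factorial_nsmul_multichoose_eq_ascPochhammer s k
  rw [Polynomial.ascPochhammer_smeval_eq_eval, nsmul_eq_mul] at h
  rw [eq_div_iff (by exact_mod_cast k.factorial_ne_zero), mul_comm, h]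
  clear h
  induction k with
  | zero => simp
  | succ k ih => rw [ascPochhammer_succ_eval, Finset.prod_range_succ, ih]

lemma norm_multichoose_le {s : ℂ} {R : ℕ} (hs : ‖s‖ ≤ R + 1) (k : ℕ) :
    ‖Ring.multichoose s k‖ ≤ ((k + R).choose R : ℝ) := by
  rw [multichoose_eq_prod_div_factorial, norm_div, norm_prod, Complex.norm_natCast,
    div_le_iff₀ (by positivity)]
  have h1 : ∏ i ∈ Finset.range k, ‖s + i‖ ≤ ∏ i ∈ Finset.range k, ((R : ℝ) + 1 + i) := by
    refine Finset.prod_le_prod (fun _ _ => norm_nonneg _) fun i _ => ?_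
    refine (norm_add_le _ _).trans ?_
    rw [Complex.norm_natCast]
    gcongr
  refine h1.trans (le_of_eq ?_)
  have h2 : ∀ k : ℕ, ∏ i ∈ Finset.range k, ((R : ℝ) + 1 + i) = ((R + 1).ascFactorial k : ℝ) := by
    intro k
    induction k with
    | zero => simp
    | succ k ih => rw [Finset.prod_range_succ, ih, Nat.ascFactorial_succ]; push_cast; ring
  rw [h2, Nat.ascFactorial_eq_factorial_mul_choose, add_comm k R, Nat.choose_symm_add]
  push_cast; ring

lemma summable_norm_multichoose_mul_pow (s : ℂ) {r : ℝ} (h0 : 0 ≤ r) (hr : r < 1) :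
    Summable fun k => ‖Ring.multichoose s k‖ * r ^ k := by
  obtain ⟨R, hR⟩ := exists_nat_ge ‖s‖
  refine Summable.of_nonneg_of_le (fun k => by positivity) (fun k => ?_)
    (summable_choose_mul_geometric_of_norm_lt_one R (r := r) (by rwa [Real.norm_of_nonneg h0]))
  gcongr
  exact norm_multichoose_le (by linarith) k

/-- The binomial series with negative exponent. -/
lemma hasSum_multichoose_mul_pow (s : ℂ) {x : ℂ} (hx : ‖x‖ < 1) :
    HasSum (fun k => Ring.multichoose s k * x ^ k) ((1 - x) ^ (-s)) := by
  have h := (Complex.one_div_one_sub_cpow_hasFPowerSeriesOnBall_zero s).hasSum (y := x)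
    (by simpa [← ofReal_norm] using hx)
  simpa [FormalMultilinearSeries.ofScalars, Ring.multichoose_eq, Complex.cpow_neg, mul_comm] using h

lemma tsum_mul_tsum_pow_comm {a b x : ℕ → ℂ} {r : ℝ} (ha : Summable fun k => ‖a k‖ * r ^ k)
    (hb : Summable fun n => ‖b n‖) (hx : ∀ n, ‖x n‖ ≤ r) :
    ∑' k, a k * ∑' n, x n ^ k * b n = ∑' n, (∑' k, a k * x n ^ k) * b n := by
  have hr : 0 ≤ r := (norm_nonneg _).trans (hx 0)
  have h : Summable (Function.uncurry fun k n => a k * x n ^ k * b n) := by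
    refine Summable.of_norm_bounded (ha.mul_of_nonneg hb (fun k => by positivity)
      fun n => norm_nonneg _) ?_
    rintro ⟨k, n⟩
    simp only [Function.uncurry, norm_mul, norm_pow]
    gcongr
    exact hx n
  simp_rw [← tsum_mul_left, ← tsum_mul_right, ← mul_assoc]
  exact h.tsum_comm.symm

/-- The meromorphic continuation of `∑ n, (n + 3/2) ^ (-w)`. -/
noncomputable def halfOddZeta (w : ℂ) : ℂ := (2 ^ w - 1) * riemannZeta w - 2 ^ w

lemma natCast_add_three_half_cpow_neg (n : ℕ) (w : ℂ) :
    ((n : ℂ) + 3 / 2) ^ (-w) = 2 ^ w * (1 / ((2 * (n + 1) + 1 : ℕ) : ℂ) ^ w) := by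
  have h : ((n : ℂ) + 3 / 2) = ((2⁻¹ : ℝ) : ℂ) * ((2 * (n + 1) + 1 : ℝ) : ℂ) := by
    push_cast; ring
  rw [h, Complex.mul_cpow_ofReal_nonneg (by norm_num) (by positivity)]
  push_cast
  rw [Complex.inv_cpow _ _ (by simp [Real.pi_pos.ne]), Complex.cpow_neg,
    Complex.cpow_neg, inv_inv, one_div]

lemma hasSum_two_mul_add_one_add_one {F : ℕ → ℂ} (hF : Summable F) :
    HasSum (fun n : ℕ => F (2 * (n + 1) + 1)) (∑' n, F n - ∑' n, F (2 * n) - F 1) := by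
  have hodd : Summable fun n : ℕ => F (2 * n + 1) :=
    hF.comp_injective (i := fun n : ℕ => 2 * n + 1) fun a b h => by simpa using h
  have heven : Summable fun n : ℕ => F (2 * n) :=
    hF.comp_injective (i := fun n : ℕ => 2 * n) fun a b h => by simpa using h
  have hodd' : Summable fun n : ℕ => F (2 * (n + 1) + 1) :=
    hodd.comp_injective (i := fun n : ℕ => n + 1) fun a b h => by simpa using h
  have hsplit := tsum_even_add_odd heven hodd
  rw [hodd.tsum_eq_zero_add] at hsplit
  convert hodd'.hasSum using 1
  rw [← hsplit]
  ring

lemma hasSum_halfOddZeta {w : ℂ} (hw : 1 < w.re) :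
    HasSum (fun n : ℕ => ((n : ℂ) + 3 / 2) ^ (-w)) (halfOddZeta w) := by
  have hs : Summable fun n : ℕ => 1 / (n : ℂ) ^ w := Complex.summable_one_div_nat_cpow.mpr hw
  have hz := zeta_eq_tsum_one_div_nat_cpow hw
  have he : ∀ n : ℕ, 1 / ((2 * n : ℕ) : ℂ) ^ w = 2 ^ (-w) * (1 / (n : ℂ) ^ w) := by
    intro n
    rw [Nat.cast_mul, Complex.natCast_mul_natCast_cpow, Complex.cpow_neg, one_div, mul_inv,
      one_div, Nat.cast_ofNat]
  have h2 : (2 : ℂ) ^ w * 2 ^ (-w) = 1 := by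
    rw [← Complex.cpow_add _ _ two_ne_zero, add_neg_cancel, Complex.cpow_zero]
  have hsum := (hasSum_two_mul_add_one_add_one hs).mul_left ((2 : ℂ) ^ w)
  rw [tsum_congr he, tsum_mul_left, ← hz, Nat.cast_one, Complex.one_cpow, div_one] at hsum
  have hval : halfOddZeta w = 2 ^ w * (riemannZeta w - 2 ^ (-w) * riemannZeta w - 1) := by
    rw [halfOddZeta]
    linear_combination riemannZeta w * h2
  rw [hval]
  exact hsum.congr_fun fun n => natCast_add_three_half_cpow_neg n w

lemma norm_cpow_neg_eq (n : ℕ) (w : ℂ) :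
    ‖((n : ℂ) + 3 / 2) ^ (-w)‖ = ((n : ℝ) + 3 / 2) ^ (-w.re) := by
  have h : ((n : ℂ) + 3 / 2) = (((n : ℝ) + 3 / 2 : ℝ) : ℂ) := by push_cast; ring
  rw [h, Complex.norm_cpow_eq_rpow_re_of_pos (by positivity), Complex.neg_re]

lemma summable_norm_cpow_neg {w : ℂ} (hw : 1 < w.re) :
    Summable fun n : ℕ => ‖((n : ℂ) + 3 / 2) ^ (-w)‖ :=
  (hasSum_halfOddZeta hw).summable.norm

lemma norm_halfOddZeta_le {w : ℂ} (hw : 3 / 2 ≤ w.re) :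
    ‖halfOddZeta w‖ ≤ ∑' n : ℕ, ((n : ℝ) + 3 / 2) ^ (-(3 / 2 : ℝ)) := by
  have h1 := hasSum_halfOddZeta (w := w) (by linarith)
  have h2 : Summable fun n : ℕ => ((n : ℝ) + 3 / 2) ^ (-(3 / 2 : ℝ)) := by
    have := summable_norm_cpow_neg (w := ((3 / 2 : ℝ) : ℂ)) (by norm_num)
    simpa only [norm_cpow_neg_eq, Complex.ofReal_re] using this
  rw [← h1.tsum_eq]
  refine tsum_of_norm_bounded h2.hasSum fun n => ?_
  rw [norm_cpow_neg_eq]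
  exact Real.rpow_le_rpow_of_exponent_le (by linarith [n.cast_nonneg (α := ℝ)]) (by linarith)

lemma differentiableAt_halfOddZeta {w : ℂ} (hw : w ≠ 1) : DifferentiableAt ℂ halfOddZeta w := by
  have := differentiableAt_riemannZeta hw
  have h2 : DifferentiableAt ℂ (fun w : ℂ => (2 : ℂ) ^ w) w :=
    differentiableAt_id.const_cpow (Or.inl two_ne_zero)
  exact ((h2.sub_const 1).mul this).sub h2

lemma meromorphicAt_riemannZeta (w : ℂ) : MeromorphicAt riemannZeta w := by
  have h : riemannZeta = fun s => (s * completedRiemannZeta₀ s - 1 - s / (1 - s)) *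
      ((2 * (Real.pi : ℂ) ^ (-s / 2))⁻¹ * (Complex.Gamma (s / 2 + 1))⁻¹) := by
    funext s
    rw [riemannZeta_eq_mul_completedRiemannZeta₀, div_eq_mul_inv, mul_inv]
  have hG : AnalyticAt ℂ (fun s : ℂ => (Complex.Gamma (s / 2 + 1))⁻¹) w :=
    Differentiable.analyticAt (Complex.differentiable_one_div_Gamma.comp
      ((differentiable_id.div_const 2).add_const 1)) w
  have hP : AnalyticAt ℂ (fun s : ℂ => (2 * (Real.pi : ℂ) ^ (-s / 2))) w :=
    Differentiable.analyticAt (Differentiable.const_mul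
      ((differentiable_id.neg.div_const 2).const_cpow
        (Or.inl (by exact_mod_cast Real.pi_ne_zero))) 2) w
  have hc := (differentiable_completedZeta₀.analyticAt w).meromorphicAt
  have hid : MeromorphicAt (fun s : ℂ => s) w := MeromorphicAt.id w
  have h1 : MeromorphicAt (fun s : ℂ => (1 : ℂ)) w := MeromorphicAt.const 1 w
  rw [h]
  exact (((hid.mul hc).sub h1).sub (hid.div (h1.sub hid))).mul
    (hP.meromorphicAt.inv.mul hG.meromorphicAt)

/-- The `k`-th term in the expansion of `∑ n, ((n + 3/2)² - 1/4) ^ (-s)` in powers of `1/4`. -/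
noncomputable def expansionTerm (k : ℕ) (s : ℂ) : ℂ :=
  Ring.multichoose s k * ((1 / 4) ^ k * halfOddZeta (2 * s + 2 * k))

/-- The meromorphic continuation of `∑ n, ((n + 1) (n + 2)) ^ (-s)`. -/
noncomputable def expansionSum (s : ℂ) : ℂ := ∑' k, expansionTerm k s

lemma one_quarter_pow_mul_cpow (s : ℂ) (k n : ℕ) :
    (1 / 4 : ℂ) ^ k * ((n : ℂ) + 3 / 2) ^ (-(2 * s + 2 * k)) =
      (1 / 4 * (((n : ℂ) + 3 / 2) ^ 2)⁻¹) ^ k * ((n : ℂ) + 3 / 2) ^ (-(2 * s)) := by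
  have h : ((n : ℂ) + 3 / 2) ≠ 0 := by
    have : ((n : ℂ) + 3 / 2) = (((n : ℝ) + 3 / 2 : ℝ) : ℂ) := by push_cast; ring
    rw [this]
    exact_mod_cast (by positivity : (n : ℝ) + 3 / 2 ≠ 0)
  have h2 : -(2 * s + 2 * k) = -(2 * s) + -((2 * k : ℕ) : ℂ) := by push_cast; ring
  rw [h2, Complex.cpow_add _ _ h, Complex.cpow_neg _ ((2 * k : ℕ) : ℂ), Complex.cpow_natCast,
    pow_mul, mul_pow, inv_pow]
  ring

lemma norm_one_quarter_mul_inv_sq_le (n : ℕ) : ‖1 / 4 * (((n : ℂ) + 3 / 2) ^ 2)⁻¹‖ ≤ 1 / 4 := by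
  have h : 1 / 4 * (((n : ℂ) + 3 / 2) ^ 2)⁻¹ = ((1 / 4 * (((n : ℝ) + 3 / 2) ^ 2)⁻¹ : ℝ) : ℂ) := by
    push_cast; ring
  rw [h, Complex.norm_real, Real.norm_of_nonneg (by positivity)]
  have : (((n : ℝ) + 3 / 2) ^ 2)⁻¹ ≤ 1 :=
    inv_le_one_of_one_le₀ (by nlinarith [n.cast_nonneg (α := ℝ)])
  linarith

lemma one_sub_cpow_mul_cpow (s : ℂ) (n : ℕ) :
    (1 - 1 / 4 * (((n : ℂ) + 3 / 2) ^ 2)⁻¹) ^ (-s) * ((n : ℂ) + 3 / 2) ^ (-(2 * s)) =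
      (((n : ℂ) + 1) * ((n : ℂ) + 2)) ^ (-s) := by
  have hm : (0 : ℝ) < n + 3 / 2 := by positivity
  have h1 : 1 - 1 / 4 * (((n : ℂ) + 3 / 2) ^ 2)⁻¹ =
      ((((n : ℝ) + 1) * (n + 2) / (n + 3 / 2) ^ 2 : ℝ) : ℂ) := by
    have : 1 - 1 / 4 * (((n : ℝ) + 3 / 2) ^ 2)⁻¹ = ((n : ℝ) + 1) * (n + 2) / (n + 3 / 2) ^ 2 := by
      field_simp; ring
    rw [← this]; push_cast; ring
  have h2 : ((n : ℂ) + 3 / 2) ^ (-(2 * s)) = (((n + 3 / 2) ^ 2 : ℝ) : ℂ) ^ (-s) := by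
    have h3 : ((n : ℂ) + 3 / 2) = (((n : ℝ) + 3 / 2 : ℝ) : ℂ) := by push_cast; ring
    rw [h3, sq, Complex.ofReal_mul, Complex.mul_cpow_ofReal_nonneg hm.le hm.le,
      ← Complex.cpow_add _ _ (by exact_mod_cast hm.ne')]
    congr 1; ring
  rw [h1, h2, ← Complex.mul_cpow_ofReal_nonneg (by positivity) (by positivity),
    ← Complex.ofReal_mul,
    div_mul_cancel₀ _ (by positivity)]
  push_cast; rfl

lemma expansionSum_eq_tsum {s : ℂ} (hs : 1 < s.re) :
    expansionSum s = ∑' n : ℕ, (((n : ℂ) + 1) * ((n : ℂ) + 2)) ^ (-s) := by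
  have hre (k : ℕ) : 1 < (2 * s + 2 * k : ℂ).re := by
    simp
    linarith [k.cast_nonneg (α := ℝ)]
  simp_rw [expansionSum, expansionTerm, ← (hasSum_halfOddZeta (hre _)).tsum_eq,
    ← tsum_mul_left (a := (1 / 4 : ℂ) ^ _), one_quarter_pow_mul_cpow]
  rw [tsum_mul_tsum_pow_comm (r := 1 / 4)
    (summable_norm_multichoose_mul_pow s (by norm_num) (by norm_num))
    (summable_norm_cpow_neg (by simpa using hre 0)) norm_one_quarter_mul_inv_sq_le]
  refine tsum_congr fun n => ?_
  rw [(hasSum_multichoose_mul_pow s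
    ((norm_one_quarter_mul_inv_sq_le n).trans_lt (by norm_num))).tsum_eq, one_sub_cpow_mul_cpow]

lemma differentiable_multichoose (k : ℕ) : Differentiable ℂ fun s : ℂ => Ring.multichoose s k := by
  simp_rw [multichoose_eq_prod_div_factorial]
  fun_prop

lemma meromorphicAt_expansionTerm (k : ℕ) (s : ℂ) : MeromorphicAt (expansionTerm k) s := by
  have hl : AnalyticAt ℂ (fun s : ℂ => 2 * s + 2 * k) s := by fun_prop
  have hp : AnalyticAt ℂ (fun w : ℂ => (2 : ℂ) ^ w) (2 * s + 2 * k) :=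
    Differentiable.analyticAt (differentiable_id.const_cpow (Or.inl two_ne_zero)) _
  have hH : MeromorphicAt halfOddZeta (2 * s + 2 * k) :=
    ((hp.meromorphicAt.sub (MeromorphicAt.const 1 _)).mul (meromorphicAt_riemannZeta _)).sub
      hp.meromorphicAt
  exact ((differentiable_multichoose k).analyticAt s).meromorphicAt.mul
    ((MeromorphicAt.const _ s).mul
      (MeromorphicAt.comp_analyticAt (g := fun s : ℂ => 2 * s + 2 * k) hH hl))

lemma differentiableAt_expansionTerm {k : ℕ} {s : ℂ} (h : 2 * s + 2 * k ≠ 1) :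
    DifferentiableAt ℂ (expansionTerm k) s :=
  (differentiable_multichoose k s).mul (((differentiableAt_halfOddZeta h).comp s
    (by fun_prop : DifferentiableAt ℂ (fun s : ℂ => 2 * s + 2 * k) s)).const_mul _)

lemma three_half_le_re {r : ℝ} {K k : ℕ} (hK : r + 3 / 4 ≤ K) {s : ℂ} (hs : s ∈ Metric.ball 0 r) :
    3 / 2 ≤ (2 * s + 2 * (k + K : ℕ) : ℂ).re := by
  have h1 := (abs_le.mp (Complex.abs_re_le_norm s)).1
  rw [mem_ball_zero_iff] at hs
  simp
  linarith [k.cast_nonneg (α := ℝ)]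

lemma differentiableOn_expansionTerm_add {r : ℝ} {K : ℕ} (hK : r + 3 / 4 ≤ K) (k : ℕ) :
    DifferentiableOn ℂ (expansionTerm (k + K)) (Metric.ball 0 r) := fun s hs =>
  (differentiableAt_expansionTerm fun h => by
    have := three_half_le_re (k := k) hK hs
    rw [h, Complex.one_re] at this
    linarith).differentiableWithinAt

lemma exists_summable_bound_expansionTerm {r : ℝ} {K : ℕ} (hK : r + 3 / 4 ≤ K) :
    ∃ u : ℕ → ℝ, Summable u ∧ ∀ k, ∀ s ∈ Metric.ball (0 : ℂ) r, ‖expansionTerm (k + K) s‖ ≤ u k := by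
  obtain ⟨R, hR⟩ := exists_nat_ge r
  refine ⟨fun k => ((k + K + R).choose R : ℝ) * (1 / 4) ^ (k + K) *
    ∑' n : ℕ, ((n : ℝ) + 3 / 2) ^ (-(3 / 2 : ℝ)), ?_, fun k s hs => ?_⟩
  · refine Summable.mul_right _ ?_
    exact (summable_nat_add_iff K).mpr
      (summable_choose_mul_geometric_of_norm_lt_one R (r := (1 / 4 : ℝ)) (by norm_num))
  · have h1 : ‖s‖ ≤ R + 1 := by
      rw [mem_ball_zero_iff] at hs
      linarith
    have h2 := norm_halfOddZeta_le (three_half_le_re (k := k) hK hs)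
    have h3 := norm_multichoose_le h1 (k + K)
    rw [expansionTerm, norm_mul, norm_mul, norm_pow, ← mul_assoc]
    norm_num at h2 h3 ⊢
    gcongr

lemma expansionSum_eq_sum_add_tsum {r : ℝ} {K : ℕ} (hK : r + 3 / 4 ≤ K) {s : ℂ}
    (hs : s ∈ Metric.ball 0 r) :
    expansionSum s = ∑ k ∈ Finset.range K, expansionTerm k s + ∑' k, expansionTerm (k + K) s := by
  obtain ⟨u, hu, hle⟩ := exists_summable_bound_expansionTerm hK
  have : Summable fun k => expansionTerm (k + K) s :=
    Summable.of_norm_bounded hu fun k => hle k s hs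
  exact (Summable.sum_add_tsum_nat_add (f := fun k => expansionTerm k s) K
    ((summable_nat_add_iff (f := fun k => expansionTerm k s) K).mp this)).symm

lemma differentiableOn_tsum_expansionTerm {r : ℝ} {K : ℕ} (hK : r + 3 / 4 ≤ K) :
    DifferentiableOn ℂ (fun s => ∑' k, expansionTerm (k + K) s) (Metric.ball 0 r) := by
  obtain ⟨u, hu, hle⟩ := exists_summable_bound_expansionTerm hK
  exact Complex.differentiableOn_tsum_of_summable_norm hu
    (differentiableOn_expansionTerm_add hK) Metric.isOpen_ball hle

lemma meromorphicAt_expansionSum (s : ℂ) : MeromorphicAt expansionSum s := by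
  obtain ⟨K, hK⟩ := exists_nat_ge (‖s‖ + 1 + 3 / 4)
  have hmem : Metric.ball (0 : ℂ) (‖s‖ + 1) ∈ 𝓝 s := Metric.isOpen_ball.mem_nhds (by simp)
  have h : MeromorphicAt (fun z => ∑ k ∈ Finset.range K, expansionTerm k z +
      ∑' k, expansionTerm (k + K) z) s :=
    (MeromorphicAt.fun_sum fun k _ => meromorphicAt_expansionTerm k s).add
      ((differentiableOn_tsum_expansionTerm hK).analyticAt hmem).meromorphicAt
  refine h.congr (Filter.EventuallyEq.filter_mono ?_ nhdsWithin_le_nhds)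
  filter_upwards [hmem] with z hz
  exact (expansionSum_eq_sum_add_tsum hK hz).symm

lemma expansionSum_eventuallyEq_zero :
    expansionSum =ᶠ[𝓝 0] fun s => halfOddZeta (2 * s) + ∑' k, expansionTerm (k + 1) s := by
  filter_upwards [Metric.ball_mem_nhds (0 : ℂ) (ε := 1 / 4) (by norm_num)] with s hs
  rw [expansionSum_eq_sum_add_tsum (K := 1) (by norm_num) hs]
  simp [expansionTerm]

lemma hasDerivAt_halfOddZeta_two_mul :
    HasDerivAt (fun s : ℂ => halfOddZeta (2 * s)) (-3 * Complex.log 2) 0 := by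
  have h1 : HasDerivAt (fun s : ℂ => (2 : ℂ) ^ s) (Complex.log 2) 0 := by
    simpa using (hasDerivAt_id (0 : ℂ)).const_cpow (c := 2) (Or.inl two_ne_zero)
  have h2 : HasDerivAt halfOddZeta (-3 / 2 * Complex.log 2) 0 := by
    have h3 := (differentiableAt_riemannZeta (s := 0) zero_ne_one).hasDerivAt
    refine (((h1.sub_const 1).mul h3).sub h1).congr_deriv ?_
    rw [Complex.cpow_zero, riemannZeta_zero]
    ring
  have h4 : HasDerivAt (fun s : ℂ => 2 * s) 2 0 := by
    simpa using (hasDerivAt_id (0 : ℂ)).const_mul 2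
  have h5 : HasDerivAt halfOddZeta (-3 / 2 * Complex.log 2) (2 * 0) := by rwa [mul_zero]
  refine (h5.comp 0 h4).congr_deriv ?_
  ring

lemma hasDerivAt_expansionTerm_succ (k : ℕ) :
    HasDerivAt (expansionTerm (k + 1))
      (1 / (k + 1) * ((1 / 4) ^ (k + 1) * halfOddZeta (2 * 0 + 2 * (k + 1 : ℕ)))) 0 := by
  have hH : DifferentiableAt ℂ
      (fun s : ℂ => (1 / 4 : ℂ) ^ (k + 1) * halfOddZeta (2 * s + 2 * (k + 1 : ℕ))) 0 := by
    refine ((differentiableAt_halfOddZeta ?_).comp (0 : ℂ)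
      (by fun_prop : DifferentiableAt ℂ (fun s : ℂ => 2 * s + 2 * (k + 1 : ℕ)) 0)).const_mul _
    norm_cast
    omega
  set g : ℂ → ℂ := fun s => (∏ i ∈ Finset.range k, (s + (i + 1 : ℕ))) / (k + 1).factorial with hg
  have hgd : DifferentiableAt ℂ g 0 := by fun_prop
  have hmul : ∀ s : ℂ, Ring.multichoose s (k + 1) = s * g s := by
    intro s
    rw [multichoose_eq_prod_div_factorial, Finset.prod_range_succ', hg]
    simp only [Nat.cast_zero, add_zero]
    ring
  have hg0 : g 0 = 1 / (k + 1) := by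
    have hf : (k.factorial : ℂ) ≠ 0 := by exact_mod_cast k.factorial_ne_zero
    have hk : (k : ℂ) + 1 ≠ 0 := by exact_mod_cast k.succ_ne_zero
    simp only [hg, zero_add]
    rw [← Nat.cast_prod, Finset.prod_range_add_one_eq_factorial, Nat.factorial_succ]
    push_cast
    field_simp
  have heq : expansionTerm (k + 1) = fun s =>
      s * (g s * ((1 / 4) ^ (k + 1) * halfOddZeta (2 * s + 2 * (k + 1 : ℕ)))) := by
    funext s
    rw [expansionTerm, hmul, mul_assoc]
  rw [heq]
  refine ((hasDerivAt_id (0 : ℂ)).mul (hgd.mul hH).hasDerivAt).congr_deriv ?_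
  simp [hg0]

lemma tendsto_prod_sq_div :
    Tendsto (fun N : ℕ => ∏ n ∈ Finset.range N, ((n : ℝ) + 3 / 2) ^ 2 / ((n + 1) * (n + 2)))
      atTop (𝓝 (4 / Real.pi)) := by
  have hW := Real.Wallis.tendsto_W_nhds_pi_div_two
  have hmul : ∀ N : ℕ, ∏ n ∈ Finset.range N, ((n : ℝ) + 3 / 2) ^ 2 / ((n + 1) * (n + 2)) =
      (2 - 1 / ((N : ℝ) + 1)) / Real.Wallis.W N := by
    intro N
    rw [eq_div_iff (Real.Wallis.W_pos N).ne']
    induction N with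
    | zero => norm_num [Real.Wallis.W]
    | succ N ih =>
      rw [Real.Wallis.W_succ, Finset.prod_range_succ, mul_mul_mul_comm, ih]
      push_cast
      field_simp
      ring
  have h := (tendsto_const_nhds (x := (2 : ℝ))).sub
    (tendsto_one_div_add_atTop_nhds_zero_nat (𝕜 := ℝ))
  have h2 := h.div hW (by positivity)
  refine (h2.congr fun N => (hmul N).symm).trans (le_of_eq ?_)
  congr 1
  field_simp
  norm_num

lemma hasSum_neg_log_one_sub :
    HasSum (fun n : ℕ => -Real.log (1 - 1 / 4 * (((n : ℝ) + 3 / 2) ^ 2)⁻¹))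
      (Real.log (4 / Real.pi)) := by
  have hx : ∀ n : ℕ, -Real.log (1 - 1 / 4 * (((n : ℝ) + 3 / 2) ^ 2)⁻¹) =
      Real.log (((n : ℝ) + 3 / 2) ^ 2 / ((n + 1) * (n + 2))) := by
    intro n
    rw [← Real.log_inv]
    congr 1
    have hm : (0 : ℝ) < n + 3 / 2 := by positivity
    have : 1 - 1 / 4 * (((n : ℝ) + 3 / 2) ^ 2)⁻¹ = ((n : ℝ) + 1) * (n + 2) / (n + 3 / 2) ^ 2 := by
      field_simp; ring
    rw [this, inv_div]
  simp_rw [hx]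
  rw [hasSum_iff_tendsto_nat_of_nonneg]
  · have h := (Real.continuousAt_log (by positivity : 4 / Real.pi ≠ 0)).tendsto.comp
      tendsto_prod_sq_div
    refine h.congr fun N => ?_
    rw [Function.comp_apply, Real.log_prod fun n _ => by positivity]
  · intro n
    refine Real.log_nonneg ?_
    rw [one_le_div (by positivity)]
    nlinarith

lemma hasDerivAt_tsum_expansionTerm_succ :
    HasDerivAt (fun s => ∑' k, expansionTerm (k + 1) s) (Real.log (4 / Real.pi) : ℂ) 0 := by
  have hK : (1 / 4 : ℝ) + 3 / 4 ≤ (1 : ℕ) := by norm_num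
  have h0 : (0 : ℂ) ∈ Metric.ball (0 : ℂ) (1 / 4) := by simp
  obtain ⟨u, hu, hle⟩ := exists_summable_bound_expansionTerm hK
  have hd := ((differentiableOn_tsum_expansionTerm hK).differentiableAt
    (Metric.isOpen_ball.mem_nhds h0)).hasDerivAt
  refine hd.congr_deriv ?_
  rw [← (Complex.hasSum_deriv_of_summable_norm hu (differentiableOn_expansionTerm_add hK)
    Metric.isOpen_ball hle h0).tsum_eq]
  simp_rw [(hasDerivAt_expansionTerm_succ _).deriv]
  have hre (k : ℕ) : 1 < (2 * 0 + 2 * (k + 1 : ℕ) : ℂ).re := by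
    simp
    linarith [k.cast_nonneg (α := ℝ)]
  simp_rw [← (hasSum_halfOddZeta (hre _)).tsum_eq, ← tsum_mul_left (a := (1 / 4 : ℂ) ^ _),
    one_quarter_pow_mul_cpow, mul_zero, neg_zero, Complex.cpow_zero, mul_one,
    pow_succ (1 / 4 * _ : ℂ)]
  have hx2 : Summable fun n : ℕ => ‖1 / 4 * (((n : ℂ) + 3 / 2) ^ 2)⁻¹‖ := by
    have := (summable_norm_cpow_neg (w := 2) (by simp)).mul_left ‖(1 / 4 : ℂ)‖
    refine this.congr fun n => ?_
    rw [← norm_mul, Complex.cpow_neg, Complex.cpow_ofNat]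
  have ha : Summable fun k : ℕ => ‖(1 / ((k : ℂ) + 1))‖ * (1 / 4 : ℝ) ^ k := by
    refine Summable.of_nonneg_of_le (fun k => by positivity) (fun k => ?_)
      (summable_geometric_of_lt_one (r := (1 / 4 : ℝ)) (by norm_num) (by norm_num))
    refine mul_le_of_le_one_left (by positivity) ?_
    rw [norm_div, norm_one, ← Nat.cast_succ, Complex.norm_natCast]
    exact div_le_one_of_le₀ (by simp) (by positivity)
  rw [tsum_mul_tsum_pow_comm ha hx2 norm_one_quarter_mul_inv_sq_le]
  refine HasSum.tsum_eq ?_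
  refine (Complex.hasSum_ofReal.mpr hasSum_neg_log_one_sub).congr_fun fun n => ?_
  have hlt : |1 / 4 * (((n : ℝ) + 3 / 2) ^ 2)⁻¹| < 1 := by
    have := norm_one_quarter_mul_inv_sq_le n
    have h : 1 / 4 * (((n : ℂ) + 3 / 2) ^ 2)⁻¹ =
        ((1 / 4 * (((n : ℝ) + 3 / 2) ^ 2)⁻¹ : ℝ) : ℂ) := by
      push_cast; ring
    rw [h, Complex.norm_real, Real.norm_eq_abs] at this
    linarith
  rw [← (Real.hasSum_pow_div_log_of_abs_lt_one hlt).tsum_eq, Complex.ofReal_tsum, ← tsum_mul_right]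
  refine tsum_congr fun k => ?_
  push_cast
  ring

lemma expansionSum_zero : expansionSum 0 = -1 := by
  rw [expansionSum_eventuallyEq_zero.eq_of_nhds]
  simp [halfOddZeta, expansionTerm]

lemma hasDerivAt_expansionSum_zero :
    HasDerivAt expansionSum (-(Real.log (2 * Real.pi) : ℂ)) 0 := by
  refine ((hasDerivAt_halfOddZeta_two_mul.add
    hasDerivAt_tsum_expansionTerm_succ).congr_of_eventuallyEq expansionSum_eventuallyEq_zero).congr_deriv ?_
  rw [show Complex.log 2 = (Real.log 2 : ℂ) by simp,
    Real.log_div (by norm_num) Real.pi_ne_zero, Real.log_mul two_ne_zero Real.pi_ne_zero,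
    show (4 : ℝ) = 2 ^ 2 by norm_num, Real.log_pow]
  push_cast
  ring

lemma analyticAt_expansionSum_zero : AnalyticAt ℂ expansionSum 0 := by
  have h0 : (0 : ℂ) ∈ Metric.ball (0 : ℂ) (1 / 4) := by simp
  have hmem := Metric.isOpen_ball.mem_nhds h0
  have h1 : DifferentiableOn ℂ (fun s => halfOddZeta (2 * s)) (Metric.ball 0 (1 / 4)) := by
    intro s hs
    refine DifferentiableAt.differentiableWithinAt
      (DifferentiableAt.comp s (differentiableAt_halfOddZeta fun h => ?_) (by fun_prop))
    have : ‖2 * s‖ = 1 := by rw [h, norm_one]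
    rw [mem_ball_zero_iff] at hs
    rw [norm_mul, Complex.norm_ofNat] at this
    linarith
  exact (analyticAt_congr expansionSum_eventuallyEq_zero).mpr ((h1.analyticAt hmem).add
    ((differentiableOn_tsum_expansionTerm (by norm_num)).analyticAt hmem))

lemma AnalyticOnNhd.eventuallyEq_of_meromorphicOn {f g : ℂ → ℂ} {U : Set ℂ} {x y : ℂ}
    (hf : AnalyticOnNhd ℂ f U) (hg : MeromorphicOn g U) (hU : IsPreconnected U)
    (hx : x ∈ U) (hy : y ∈ U) (hxy : f =ᶠ[𝓝 x] g) (hgy : AnalyticAt ℂ g y) : f =ᶠ[𝓝 y] g := by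
  have hd : MeromorphicOn (f - g) U := fun z hz => (hf z hz).meromorphicAt.sub (hg z hz)
  have htop : meromorphicOrderAt (f - g) y = ⊤ := by
    by_contra h
    refine hd.meromorphicOrderAt_ne_top_of_isPreconnected hU hy hx h ?_
    rw [meromorphicOrderAt_eq_top_iff]
    filter_upwards [hxy.filter_mono nhdsWithin_le_nhds] with z hz
    simp [hz]
  rw [meromorphicOrderAt_eq_top_iff] at htop
  refine ((hf y hy).frequently_eq_iff_eventually_eq hgy).mp (Filter.Eventually.frequently ?_)
  filter_upwards [htop] with z hz
  simpa [sub_eq_zero] using hz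

lemma summable_norm_mul_cpow_neg {s : ℂ} (hs : 1 < s.re) :
    Summable fun n : ℕ => ‖(((n : ℂ) + 1) * ((n : ℂ) + 2)) ^ (-s)‖ := by
  refine Summable.of_nonneg_of_le (fun _ => norm_nonneg _) (fun n => ?_)
    ((summable_nat_add_iff 1).mpr (Real.summable_nat_rpow.mpr (neg_lt_neg hs)))
  have h : ((n : ℂ) + 1) * ((n : ℂ) + 2) = ((((n : ℝ) + 1) * (n + 2) : ℝ) : ℂ) := by push_cast; ring
  rw [h, Complex.norm_cpow_eq_rpow_re_of_pos (by positivity), Complex.neg_re, Nat.cast_add_one]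
  exact Real.rpow_le_rpow_of_nonpos (by positivity) (by nlinarith [n.cast_nonneg (α := ℝ)])
    (by linarith)

/-- `Z(s) = ∑_{n≥1} (n(n+1))^{-s}` converges absolutely for `Re s > 1`, and
every analytic continuation `f` of the series to `0` satisfies `f(0) = −1` and
`f′(0) = −log(2π)`. -/
theorem stmt6 :
    (∀ s : ℂ, 1 < s.re →
      Summable (fun n : ℕ => ‖(((n : ℂ) + 1) * ((n : ℂ) + 2)) ^ (-s)‖)) ∧
    ∀ f : ℂ → ℂ,
      IsContinuationAt (fun s => ∑' n : ℕ, (((n : ℂ) + 1) * ((n : ℂ) + 2)) ^ (-s)) 1 0 f →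
      f 0 = -1 ∧ deriv f 0 = -(Real.log (2 * Real.pi) : ℂ) := by
  refine ⟨fun s hs => summable_norm_mul_cpow_neg hs, ?_⟩
  rintro f ⟨U, -, hconn, h0, hsub, hf, heq⟩
  have h2 : (2 : ℂ) ∈ {s : ℂ | 1 < s.re} := by simp
  have hnear : f =ᶠ[𝓝 2] expansionSum := by
    filter_upwards [(isOpen_lt continuous_const Complex.continuous_re).mem_nhds h2] with s hs
    rw [heq s hs, expansionSum_eq_tsum hs]
  have hz : f =ᶠ[𝓝 0] expansionSum := hf.eventuallyEq_of_meromorphicOn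
    (fun s _ => meromorphicAt_expansionSum s) hconn.isPreconnected (hsub h2) h0 hnear
    analyticAt_expansionSum_zero
  exact ⟨hz.eq_of_nhds.trans expansionSum_zero,
    hz.deriv_eq.trans hasDerivAt_expansionSum_zero.deriv⟩
end

section
/- The series z(s) = ∑_{n=1}^∞ (n+1)·(n(n+2))^{-s} converges absolutely for Re(s) > 1, and every analytic continuation f of this series to the point 0 satisfies f(0) = −7/12 and f'(0) = 2·ζ'(−1) + log 2 − 1, where ζ' is the derivative of the Riemann zeta function. -/
open Filter Topology Finset

/-- The coefficient of `x ^ k` in the binomial series of `(1 - x) ^ (-s)`. -/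
noncomputable def negBinomCoeff (s : ℂ) (k : ℕ) : ℂ :=
  ∏ i ∈ range k, (s + i) / (i + 1)

lemma negBinomCoeff_zero_right (s : ℂ) : negBinomCoeff s 0 = 1 := by
  simp [negBinomCoeff]

lemma negBinomCoeff_succ (s : ℂ) (k : ℕ) :
    negBinomCoeff s (k + 1) = negBinomCoeff s k * ((s + k) / (k + 1)) := by
  rw [negBinomCoeff, prod_range_succ, negBinomCoeff]

lemma negBinomCoeff_eq_choose (s : ℂ) (k : ℕ) :
    negBinomCoeff s k = Ring.choose (s + k - 1) k := by
  have h := Ring.factorial_nsmul_multichoose_eq_ascPochhammer s k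
  have h2 : Ring.choose (s + k - 1) k = Ring.multichoose s k := by
    rw [Ring.choose]; congr 1; ring
  have h3 : (k.factorial : ℂ) * negBinomCoeff s k = (ascPochhammer ℕ k).smeval s := by
    rw [Polynomial.ascPochhammer_smeval_eq_eval]
    clear h h2
    induction k with
    | zero => simp [negBinomCoeff_zero_right]
    | succ k ih =>
      have h1 : (k : ℂ) + 1 ≠ 0 := Nat.cast_add_one_ne_zero k
      rw [ascPochhammer_succ_eval, ← ih, negBinomCoeff_succ, Nat.factorial_succ]
      push_cast
      field_simp
  have hk : (k.factorial : ℂ) ≠ 0 := by exact_mod_cast k.factorial_ne_zero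
  rw [h2]
  apply mul_left_cancel₀ hk
  rw [h3, ← h, nsmul_eq_mul]

lemma hasSum_negBinomCoeff (s : ℂ) {x : ℂ} (hx : ‖x‖ < 1) :
    HasSum (fun k => negBinomCoeff s k * x ^ k) ((1 - x) ^ (-s)) := by
  have h := (Complex.one_div_one_sub_cpow_hasFPowerSeriesOnBall_zero s).hasSum (y := x)
    (by simpa [← ofReal_norm] using hx)
  simp only [FormalMultilinearSeries.ofScalars_apply_eq, zero_add, smul_eq_mul, one_div,
    ← Complex.cpow_neg] at h
  simpa only [negBinomCoeff_eq_choose] using h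

lemma norm_negBinomCoeff_le {s : ℂ} {R : ℝ} (hs : ‖s‖ ≤ R) (k : ℕ) :
    ‖negBinomCoeff s k‖ ≤ ‖negBinomCoeff R k‖ := by
  have hR : 0 ≤ R := (norm_nonneg s).trans hs
  simp only [negBinomCoeff, norm_prod, norm_div]
  gcongr with i
  calc ‖s + i‖ ≤ ‖s‖ + ‖(i : ℂ)‖ := norm_add_le _ _
    _ ≤ R + i := by simpa using hs
    _ = ‖(R : ℂ) + i‖ := by
      rw [← Complex.ofReal_natCast, ← Complex.ofReal_add, Complex.norm_of_nonneg (by positivity)]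

lemma summable_norm_negBinomCoeff (s : ℂ) :
    Summable fun k => ‖negBinomCoeff s k‖ * (1 / 4 : ℝ) ^ k := by
  refine summable_of_ratio_norm_eventually_le (r := 1 / 2) (by norm_num) ?_
  filter_upwards [eventually_ge_atTop ⌈‖s‖⌉₊] with k hk
  have hk' : ‖s‖ ≤ k := Nat.ceil_le.1 hk
  have h1 : ‖(s + k) / (k + 1)‖ ≤ 2 := by
    rw [norm_div, ← Nat.cast_succ, Complex.norm_natCast, div_le_iff₀ (by positivity)]
    refine (norm_add_le _ _).trans ?_
    simp
    linarith
  rw [negBinomCoeff_succ, norm_mul, norm_mul, norm_mul, norm_norm, norm_norm, norm_mul, pow_succ]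
  rw [norm_mul]
  have h2 : 0 ≤ ‖negBinomCoeff s k‖ * ‖(1 / 4 : ℝ) ^ k‖ := by positivity
  rw [show ‖(1 / 4 : ℝ)‖ = 1 / 4 by norm_num, norm_norm]
  nlinarith [mul_le_mul_of_nonneg_left h1 h2]

lemma differentiable_negBinomCoeff (k : ℕ) : Differentiable ℂ fun s => negBinomCoeff s k := by
  induction k with
  | zero => simp [negBinomCoeff_zero_right]
  | succ k ih => simp only [negBinomCoeff_succ]; fun_prop

lemma negBinomCoeff_zero_left_succ (k : ℕ) : negBinomCoeff 0 (k + 1) = 0 := by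
  induction k with
  | zero => simp [negBinomCoeff]
  | succ k ih => rw [negBinomCoeff_succ, ih, zero_mul]

lemma hasDerivAt_negBinomCoeff_succ (k : ℕ) :
    HasDerivAt (fun s => negBinomCoeff s (k + 1)) (1 / (k + 1)) 0 := by
  induction k with
  | zero => simpa [negBinomCoeff] using hasDerivAt_id' (0 : ℂ)
  | succ k ih =>
    simp only [negBinomCoeff_succ _ (k + 1)]
    refine (ih.mul (((hasDerivAt_id (0 : ℂ)).add_const _).div_const _)).congr_deriv ?_
    have h1 : (k : ℂ) + 1 ≠ 0 := Nat.cast_add_one_ne_zero k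
    have h2 : (k : ℂ) + 1 + 1 ≠ 0 := by
      simpa using Nat.cast_add_one_ne_zero (R := ℂ) (k + 1)
    simp only [id, negBinomCoeff_zero_left_succ]
    push_cast
    field_simp
    ring

lemma hasSum_riemannZeta_sub_one {w : ℂ} (hw : 1 < w.re) :
    HasSum (fun n : ℕ => ((n : ℂ) + 2) ^ (-w)) (riemannZeta w - 1) := by
  have hs : Summable fun n : ℕ => 1 / (n : ℂ) ^ w := Complex.summable_one_div_nat_cpow.2 hw
  have h := (hasSum_nat_add_iff' 2).2 hs.hasSum
  rw [← zeta_eq_tsum_one_div_nat_cpow hw] at h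
  have hw0 : w ≠ 0 := by rintro rfl; norm_num at hw
  simpa [sum_range_succ, hw0, Complex.cpow_neg] using h

lemma norm_natCast_add_two_cpow (n : ℕ) (w : ℂ) :
    ‖((n : ℂ) + 2) ^ w‖ = ((n : ℝ) + 2) ^ w.re := by
  have h := Complex.norm_natCast_cpow_of_pos (n := n + 2) (by omega) w
  push_cast at h
  exact h

lemma summable_add_two_rpow {x : ℝ} (hx : x < -1) : Summable fun n : ℕ => ((n : ℝ) + 2) ^ x := by
  have h := (summable_nat_add_iff 2).2 (Real.summable_nat_rpow.2 hx)
  simpa using h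

/-- A decay estimate for `ζ - 1` on the half-plane `2 ≤ re w`. -/
lemma norm_riemannZeta_sub_one_le {w : ℂ} (hw : 2 ≤ w.re) :
    ‖riemannZeta w - 1‖ ≤ (2 : ℝ) ^ (2 - w.re) * ∑' n : ℕ, ((n : ℝ) + 2) ^ (-2 : ℝ) := by
  rw [← (hasSum_riemannZeta_sub_one (by linarith : 1 < w.re)).tsum_eq]
  refine tsum_of_norm_bounded
    ((summable_add_two_rpow (by norm_num : (-2 : ℝ) < -1)).hasSum.mul_left _) fun n => ?_
  rw [norm_natCast_add_two_cpow, Complex.neg_re,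
    show -w.re = (2 - w.re) + (-2) by ring, Real.rpow_add (by positivity)]
  gcongr ?_ * _
  exact Real.rpow_le_rpow_of_nonpos (by norm_num) (by linarith [n.cast_nonneg (α := ℝ)]) (by linarith)

/-- The entire function `ζ(w) - 1 / (w - 1)`. -/
noncomputable def zetaRegular : ℂ → ℂ :=
  Function.update (fun w => riemannZeta w - 1 / (w - 1)) 1 Real.eulerMascheroniConstant

lemma zetaRegular_one : zetaRegular 1 = Real.eulerMascheroniConstant := by
  simp [zetaRegular]

lemma zetaRegular_of_ne {w : ℂ} (hw : w ≠ 1) : zetaRegular w = riemannZeta w - 1 / (w - 1) := by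
  simp [zetaRegular, hw]

lemma differentiable_zetaRegular : Differentiable ℂ zetaRegular := by
  have hne {w : ℂ} (hw : w ≠ 1) : DifferentiableAt ℂ zetaRegular w := by
    have h : DifferentiableAt ℂ (fun w => riemannZeta w - 1 / (w - 1)) w :=
      (differentiableAt_riemannZeta hw).sub
        ((differentiableAt_const _).div (by fun_prop) (sub_ne_zero.2 hw))
    refine h.congr_of_eventuallyEq ?_
    filter_upwards [isOpen_ne.mem_nhds hw] with z hz using zetaRegular_of_ne hz
  intro w
  rcases eq_or_ne w 1 with rfl | hw
  · refine (Complex.analyticAt_of_differentiable_on_punctured_nhds_of_continuousAt ?_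
      ?_).differentiableAt
    · filter_upwards [self_mem_nhdsWithin] with z hz using hne hz
    · exact continuousAt_update_same.2 tendsto_riemannZeta_sub_one_div
  · exact hne hw

/-- The terms of the entire part of the continuation: `(s)ₖ₊₁ / (k + 1)! * (ζ(2s + 2k + 1) - 1)`
with the removable singularity at `s = -k` filled in. -/
noncomputable def continuationTerm (k : ℕ) (s : ℂ) : ℂ :=
  negBinomCoeff s (k + 1) * (zetaRegular (2 * s + 2 * k + 1) - 1) +
    negBinomCoeff s k / (2 * (k + 1))

lemma differentiable_continuationTerm (k : ℕ) : Differentiable ℂ (continuationTerm k) := by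
  have h1 := differentiable_negBinomCoeff k
  have h2 := differentiable_negBinomCoeff (k + 1)
  have h3 : Differentiable ℂ fun s : ℂ => zetaRegular (2 * s + 2 * k + 1) :=
    differentiable_zetaRegular.comp (by fun_prop)
  unfold continuationTerm
  fun_prop

lemma continuationTerm_eq {k : ℕ} {s : ℂ} (h : s + k ≠ 0) :
    continuationTerm k s =
      negBinomCoeff s (k + 1) * (riemannZeta (2 * s + 2 * k + 1) - 1) := by
  have h1 : (k : ℂ) + 1 ≠ 0 := Nat.cast_add_one_ne_zero k
  have h2 : 2 * s + 2 * (k : ℂ) + 1 - 1 ≠ 0 := by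
    rw [show 2 * s + 2 * (k : ℂ) + 1 - 1 = 2 * (s + k) by ring]
    exact mul_ne_zero two_ne_zero h
  rw [continuationTerm, zetaRegular_of_ne (sub_ne_zero.1 h2), negBinomCoeff_succ,
    show 2 * s + 2 * (k : ℂ) + 1 - 1 = 2 * (s + k) by ring]
  field_simp
  ring

lemma norm_continuationTerm_le {R : ℝ} {k : ℕ} {s : ℂ} (hs : ‖s‖ ≤ R) (hk : R + 1 ≤ k) :
    ‖continuationTerm k s‖ ≤ ((2 : ℝ) ^ (2 * R + 3) * ∑' n : ℕ, ((n : ℝ) + 2) ^ (-2 : ℝ)) *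
      (‖negBinomCoeff R (k + 1)‖ * (1 / 4 : ℝ) ^ (k + 1)) := by
  have hre : -R ≤ s.re := (neg_le_neg hs).trans (abs_le.1 (Complex.abs_re_le_norm s)).1
  have hne : s + k ≠ 0 := by
    intro h
    have := congrArg Complex.re h
    simp at this
    linarith
  have hw : 2 * k + 1 - 2 * R ≤ (2 * s + 2 * k + 1).re := by
    simp
    linarith
  have hz := norm_riemannZeta_sub_one_le (w := 2 * s + 2 * k + 1) (by linarith)
  have hpow : (2 : ℝ) ^ (2 - (2 * s + 2 * k + 1).re) ≤
      (2 : ℝ) ^ (2 * R + 3) * (1 / 4 : ℝ) ^ (k + 1) := by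
    calc (2 : ℝ) ^ (2 - (2 * s + 2 * k + 1).re)
      _ ≤ (2 : ℝ) ^ ((2 * R + 3) + (-2) * ((k + 1 : ℕ) : ℝ)) :=
        Real.rpow_le_rpow_of_exponent_le one_le_two (by push_cast; linarith)
      _ = _ := by
        rw [Real.rpow_add two_pos, Real.rpow_mul two_pos.le, Real.rpow_natCast]
        congr 2
        norm_num [Real.rpow_neg]
  have hZ : 0 ≤ ∑' n : ℕ, ((n : ℝ) + 2) ^ (-2 : ℝ) := tsum_nonneg fun n => by positivity
  rw [continuationTerm_eq hne, norm_mul]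
  calc _ ≤ ‖negBinomCoeff R (k + 1)‖ * (((2 : ℝ) ^ (2 * R + 3) * (1 / 4 : ℝ) ^ (k + 1)) *
        ∑' n : ℕ, ((n : ℝ) + 2) ^ (-2 : ℝ)) :=
        mul_le_mul (norm_negBinomCoeff_le hs _)
          (hz.trans (mul_le_mul_of_nonneg_right hpow hZ)) (norm_nonneg _) (norm_nonneg _)
    _ = _ := by ring

lemma exists_summable_bound_continuationTerm (R : ℝ) :
    ∃ u : ℕ → ℝ, Summable u ∧ ∀ k, ∀ s ∈ Metric.ball (0 : ℂ) R, ‖continuationTerm k s‖ ≤ u k := by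
  have hM (k : ℕ) : ∃ M, ∀ s ∈ Metric.closedBall (0 : ℂ) R, ‖continuationTerm k s‖ ≤ M :=
    (isCompact_closedBall 0 R).exists_bound_of_continuousOn
      (differentiable_continuationTerm k).continuous.continuousOn
  choose M hM using hM
  let C := (2 : ℝ) ^ (2 * R + 3) * ∑' n : ℕ, ((n : ℝ) + 2) ^ (-2 : ℝ)
  let v : ℕ → ℝ := fun k => C * (‖negBinomCoeff R (k + 1)‖ * (1 / 4 : ℝ) ^ (k + 1))
  have hv : Summable v :=
    ((summable_nat_add_iff 1).2 (summable_norm_negBinomCoeff R)).mul_left C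
  refine ⟨fun k => if R + 1 ≤ k then v k else M k, ?_, fun k s hs => ?_⟩
  · refine hv.congr_atTop ?_
    filter_upwards [eventually_ge_atTop ⌈R + 1⌉₊] with k hk
    rw [if_pos (Nat.ceil_le.1 hk)]
  · dsimp only
    split_ifs with h
    · exact norm_continuationTerm_le (by simpa using (Metric.mem_ball.1 hs).le) h
    · exact hM k s (Metric.ball_subset_closedBall hs)

lemma differentiable_tsum_continuationTerm :
    Differentiable ℂ fun s => ∑' k, continuationTerm k s := by
  intro s
  obtain ⟨u, hu, h⟩ := exists_summable_bound_continuationTerm (‖s‖ + 1)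
  exact (Complex.differentiableOn_tsum_of_summable_norm hu
    (fun k => (differentiable_continuationTerm k).differentiableOn) Metric.isOpen_ball
    h).differentiableAt (Metric.isOpen_ball.mem_nhds (by simp))

lemma hasSum_deriv_continuationTerm (s : ℂ) :
    HasSum (fun k => deriv (continuationTerm k) s)
      (deriv (fun s => ∑' k, continuationTerm k s) s) := by
  obtain ⟨u, hu, h⟩ := exists_summable_bound_continuationTerm (‖s‖ + 1)
  exact Complex.hasSum_deriv_of_summable_norm hu
    (fun k => (differentiable_continuationTerm k).differentiableOn) Metric.isOpen_ball
    h (by simp)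

lemma continuationTerm_zero_zero : continuationTerm 0 0 = 1 / 2 := by
  simp [continuationTerm, negBinomCoeff]

lemma continuationTerm_succ_zero (k : ℕ) : continuationTerm (k + 1) 0 = 0 := by
  simp [continuationTerm, negBinomCoeff_zero_left_succ]

lemma tsum_continuationTerm_zero : ∑' k, continuationTerm k 0 = 1 / 2 := by
  rw [tsum_eq_single 0, continuationTerm_zero_zero]
  rintro (_ | k) hk
  · exact absurd rfl hk
  · exact continuationTerm_succ_zero k

lemma hasDerivAt_continuationTerm {k : ℕ} {d : ℂ}
    (hd : HasDerivAt (fun s => negBinomCoeff s k) d 0) :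
    HasDerivAt (continuationTerm k)
      (1 / (k + 1) * (zetaRegular (2 * k + 1) - 1) + d / (2 * (k + 1))) 0 := by
  have h : DifferentiableAt ℂ (fun s : ℂ => zetaRegular (2 * s + 2 * k + 1) - 1) 0 :=
    ((differentiable_zetaRegular.comp (g := zetaRegular)
      (f := fun s : ℂ => 2 * s + 2 * k + 1) (by fun_prop)).sub_const 1) 0
  refine (((hasDerivAt_negBinomCoeff_succ k).mul h.hasDerivAt).add
    (hd.div_const (2 * ((k : ℂ) + 1)))).congr_deriv ?_
  simp [negBinomCoeff_zero_left_succ]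

lemma deriv_continuationTerm_zero :
    deriv (continuationTerm 0) 0 = Real.eulerMascheroniConstant - 1 := by
  have hd : HasDerivAt (fun s => negBinomCoeff s 0) 0 0 := by
    simpa only [negBinomCoeff_zero_right] using hasDerivAt_const (0 : ℂ) (1 : ℂ)
  rw [(hasDerivAt_continuationTerm hd).deriv]
  simp [zetaRegular_one]

lemma deriv_continuationTerm_succ (k : ℕ) :
    deriv (continuationTerm (k + 1)) 0 = (riemannZeta (2 * k + 3) - 1) / (k + 2) := by
  have h1 : (k : ℂ) + 1 ≠ 0 := Nat.cast_add_one_ne_zero k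
  have h2 : (k : ℂ) + 2 ≠ 0 := by exact_mod_cast (by omega : k + 2 ≠ 0)
  rw [(hasDerivAt_continuationTerm (hasDerivAt_negBinomCoeff_succ k)).deriv]
  have h3 : 2 * ((k + 1 : ℕ) : ℂ) + 1 - 1 ≠ 0 := by
    push_cast; simpa using h1
  rw [zetaRegular_of_ne (sub_ne_zero.1 h3)]
  push_cast
  rw [show 2 * ((k : ℂ) + 1) + 1 = 2 * k + 3 by ring, show (k : ℂ) + 1 + 1 = k + 2 by ring,
    show 2 * (k : ℂ) + 3 - 1 = 2 * (k + 1) by ring]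
  field_simp
  ring

lemma sum_range_mul_log (M : ℕ) :
    ∑ n ∈ range M, ((n : ℝ) + 2) * (-Real.log (1 - (((n : ℝ) + 2) ^ 2)⁻¹) - (((n : ℝ) + 2) ^ 2)⁻¹) =
      Real.log 2 + 1 - (harmonic (M + 1) - Real.log ((M + 1 : ℕ) : ℝ)) -
        ((M + 1 : ℕ) : ℝ) * Real.log (1 + 1 / ((M + 1 : ℕ) : ℝ)) := by
  have hlog (L : ℝ) (hL : 0 < L) : Real.log (1 + 1 / L) = Real.log (L + 1) - Real.log L := by
    rw [← Real.log_div (by positivity) hL.ne']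
    congr 1
    field_simp
  induction M with
  | zero =>
    rw [hlog _ (by simp)]
    norm_num
  | succ M ih =>
    have h1 : (0 : ℝ) < (M : ℝ) + 1 := by positivity
    have h2 : (0 : ℝ) < (M : ℝ) + 2 := by positivity
    have h3 : (0 : ℝ) < (M : ℝ) + 3 := by positivity
    have hx : 1 - (((M : ℝ) + 2) ^ 2)⁻¹ =
        (((M : ℝ) + 1) * ((M : ℝ) + 3)) / ((M : ℝ) + 2) ^ 2 := by
      field_simp
      ring
    rw [sum_range_succ, ih, hx, Real.log_div (by positivity) (by positivity),
      Real.log_mul h1.ne' h3.ne', Real.log_pow, hlog _ (by positivity), hlog _ (by positivity),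
      harmonic_succ (M + 1)]
    push_cast
    rw [show (M : ℝ) + 1 + 1 = M + 2 by ring, show (M : ℝ) + 2 + 1 = M + 3 by ring]
    field_simp
    ring

lemma hasSum_pow_div_add_two {x : ℝ} (hx : |x| < 1) :
    HasSum (fun k : ℕ => x ^ (k + 2) / (k + 2)) (-Real.log (1 - x) - x) := by
  have h := (hasSum_nat_add_iff' 1).2 (Real.hasSum_pow_div_log_of_abs_lt_one hx)
  simp only [sum_range_one, zero_add, pow_one, Nat.cast_zero, div_one] at h
  refine h.congr_fun fun k => ?_
  push_cast
  ring

lemma inv_sq_le_one_fourth (n : ℕ) : (((n : ℝ) + 2) ^ 2)⁻¹ ≤ 1 / 4 := by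
  rw [one_div]
  gcongr
  nlinarith [n.cast_nonneg (α := ℝ)]

lemma abs_inv_sq_lt_one (n : ℕ) : |(((n : ℝ) + 2) ^ 2)⁻¹| < 1 := by
  rw [abs_of_nonneg (by positivity)]
  linarith [inv_sq_le_one_fourth n]

lemma hasSum_mul_log :
    HasSum (fun n : ℕ => ((n : ℝ) + 2) *
      (-Real.log (1 - (((n : ℝ) + 2) ^ 2)⁻¹) - (((n : ℝ) + 2) ^ 2)⁻¹))
      (Real.log 2 - Real.eulerMascheroniConstant) := by
  rw [hasSum_iff_tendsto_nat_of_nonneg]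
  · simp only [sum_range_mul_log]
    have h1 := Real.tendsto_harmonic_sub_log.comp (tendsto_add_atTop_nat 1)
    have h2 := ((Real.tendsto_mul_log_one_add_div_atTop 1).comp
      tendsto_natCast_atTop_atTop).comp (tendsto_add_atTop_nat 1)
    have h := (h1.const_sub (Real.log 2 + 1)).sub h2
    rw [show Real.log 2 + 1 - Real.eulerMascheroniConstant - 1 =
      Real.log 2 - Real.eulerMascheroniConstant by ring] at h
    exact h
  · intro n
    refine mul_nonneg (by positivity) ?_
    exact (hasSum_pow_div_add_two (abs_inv_sq_lt_one n)).nonneg fun k => by positivity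

lemma tsum_riemannZeta_odd_sub_one :
    ∑' k : ℕ, (riemannZeta (2 * k + 3) - 1) / (k + 2) =
      (Real.log 2 : ℂ) - Real.eulerMascheroniConstant := by
  let b : ℕ → ℕ → ℝ := fun n k =>
    ((n : ℝ) + 2) * ((((n : ℝ) + 2) ^ 2)⁻¹ ^ (k + 2) / (k + 2))
  have hb : Summable (Function.uncurry b) := by
    have h1 : Summable fun n : ℕ => ((n : ℝ) + 2) ^ (-3 : ℝ) := summable_add_two_rpow (by norm_num)
    have h2 : Summable fun k : ℕ => (1 / 4 : ℝ) ^ k :=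
      summable_geometric_of_lt_one (by norm_num) (by norm_num)
    refine (h1.mul_of_nonneg h2 (fun n => by positivity) fun k => by positivity).of_nonneg_of_le
      (fun p => by dsimp [b, Function.uncurry]; positivity) fun ⟨n, k⟩ => ?_
    have hn : (0 : ℝ) < (n : ℝ) + 2 := by positivity
    have hk : (1 : ℝ) ≤ (k : ℝ) + 2 := by linarith [k.cast_nonneg (α := ℝ)]
    have h3 : ((n : ℝ) + 2) ^ (-3 : ℝ) = ((n : ℝ) + 2) * (((n : ℝ) + 2) ^ 2)⁻¹ ^ 2 := by
      rw [show (-3 : ℝ) = -((3 : ℕ) : ℝ) by norm_num, Real.rpow_neg hn.le, Real.rpow_natCast]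
      field_simp
    simp only [Function.uncurry, b, h3]
    calc _ ≤ ((n : ℝ) + 2) * (((n : ℝ) + 2) ^ 2)⁻¹ ^ (k + 2) := by
          gcongr
          exact div_le_self (by positivity) hk
      _ = (((n : ℝ) + 2) * (((n : ℝ) + 2) ^ 2)⁻¹ ^ 2) * (((n : ℝ) + 2) ^ 2)⁻¹ ^ k := by ring
      _ ≤ _ := by gcongr; exact inv_sq_le_one_fourth n
  have hrow (n : ℕ) : ∑' k, b n k = ((n : ℝ) + 2) *
      (-Real.log (1 - (((n : ℝ) + 2) ^ 2)⁻¹) - (((n : ℝ) + 2) ^ 2)⁻¹) :=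
    ((hasSum_pow_div_add_two (abs_inv_sq_lt_one n)).mul_left _).tsum_eq
  have hcol (k : ℕ) : ((∑' n, b n k : ℝ) : ℂ) = (riemannZeta (2 * k + 3) - 1) / (k + 2) := by
    have hw : 1 < (2 * (k : ℂ) + 3).re := by
      simp
      linarith [k.cast_nonneg (α := ℝ)]
    rw [Complex.ofReal_tsum, ← ((hasSum_riemannZeta_sub_one hw).div_const ((k : ℂ) + 2)).tsum_eq]
    refine tsum_congr fun n => ?_
    have hn : (n : ℂ) + 2 ≠ 0 := by exact_mod_cast (by omega : n + 2 ≠ 0)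
    rw [show -(2 * (k : ℂ) + 3) = -((2 * k + 3 : ℕ) : ℂ) by push_cast; ring, Complex.cpow_neg,
      Complex.cpow_natCast]
    simp only [b]
    push_cast
    rw [mul_div_assoc']
    congr 1
    rw [inv_pow, ← pow_mul, show 2 * (k + 2) = 2 * k + 3 + 1 by ring, pow_succ]
    field_simp
  calc ∑' k : ℕ, (riemannZeta (2 * k + 3) - 1) / ((k : ℂ) + 2)
    _ = ((∑' k, ∑' n, b n k : ℝ) : ℂ) := by
      rw [Complex.ofReal_tsum]
      exact tsum_congr fun k => (hcol k).symm
    _ = ((∑' n, ∑' k, b n k : ℝ) : ℂ) := by rw [hb.tsum_comm]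
    _ = _ := by
      simp only [hrow]
      rw [hasSum_mul_log.tsum_eq]
      push_cast
      rfl

lemma deriv_tsum_continuationTerm_zero :
    deriv (fun s => ∑' k, continuationTerm k s) 0 = (Real.log 2 : ℂ) - 1 := by
  have h := hasSum_deriv_continuationTerm 0
  rw [← h.tsum_eq, h.summable.tsum_eq_zero_add, deriv_continuationTerm_zero]
  simp only [deriv_continuationTerm_succ]
  rw [tsum_riemannZeta_odd_sub_one]
  ring

section Expansion

variable {s : ℂ}

lemma summable_expansion (hs : 1 < s.re) :
    Summable (Function.uncurry fun n k : ℕ =>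
      negBinomCoeff s k * ((n : ℂ) + 2) ^ (-(2 * s + 2 * k - 1))) := by
  have h1 : Summable fun n : ℕ => ((n : ℝ) + 2) ^ (1 - 2 * s.re) :=
    summable_add_two_rpow (by linarith)
  refine (h1.mul_of_nonneg (summable_norm_negBinomCoeff s) (fun n => by positivity)
    fun k => by positivity).of_norm_bounded fun ⟨n, k⟩ => ?_
  have hn : (0 : ℝ) < (n : ℝ) + 2 := by positivity
  have hpow : ((n : ℝ) + 2) ^ (-(2 * s + 2 * (k : ℂ) - 1)).re =
      ((n : ℝ) + 2) ^ (1 - 2 * s.re) * (((n : ℝ) + 2) ^ 2)⁻¹ ^ k := by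
    rw [show (-(2 * s + 2 * (k : ℂ) - 1)).re = (1 - 2 * s.re) + -((2 * k : ℕ) : ℝ) by
      simp; ring, Real.rpow_add hn, Real.rpow_neg hn.le, Real.rpow_natCast, pow_mul, inv_pow]
  simp only [Function.uncurry, norm_mul, norm_natCast_add_two_cpow]
  rw [hpow]
  calc _ = ((n : ℝ) + 2) ^ (1 - 2 * s.re) *
        (‖negBinomCoeff s k‖ * (((n : ℝ) + 2) ^ 2)⁻¹ ^ k) := by ring
    _ ≤ _ := by gcongr; exact inv_sq_le_one_fourth n

lemma hasSum_expansion_term (s : ℂ) (n : ℕ) :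
    HasSum (fun k : ℕ => negBinomCoeff s k * ((n : ℂ) + 2) ^ (-(2 * s + 2 * k - 1)))
      (((n : ℂ) + 2) * (((n : ℂ) + 1) * ((n : ℂ) + 3)) ^ (-s)) := by
  let N : ℝ := n + 2
  have hN : 0 < N := by positivity
  have hNC : (N : ℂ) ≠ 0 := Complex.ofReal_ne_zero.2 hN.ne'
  have hN' : (n : ℂ) + 2 = N := by simp [N]
  have hx : (N ^ 2)⁻¹ ≤ 1 / 4 := inv_sq_le_one_fourth n
  have h := (hasSum_negBinomCoeff s (x := (((N ^ 2)⁻¹ : ℝ) : ℂ))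
    (by rw [Complex.norm_real]; exact abs_inv_sq_lt_one n)).mul_left ((N : ℂ) ^ (1 - 2 * s))
  have hfactor : ((n : ℂ) + 1) * ((n : ℂ) + 3) = ((N * N : ℝ) : ℂ) * ((1 - (N ^ 2)⁻¹ : ℝ) : ℂ) := by
    push_cast
    field_simp
    rw [← hN']
    ring
  have hsum : ((n : ℂ) + 2) * (((n : ℂ) + 1) * ((n : ℂ) + 3)) ^ (-s) =
      (N : ℂ) ^ (1 - 2 * s) * (1 - (((N ^ 2)⁻¹ : ℝ) : ℂ)) ^ (-s) := by
    rw [hfactor, Complex.mul_cpow_ofReal_nonneg (by positivity) (by linarith), Complex.ofReal_mul,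
      Complex.mul_cpow_ofReal_nonneg hN.le hN.le, hN',
      show 1 - 2 * s = 1 + (-s) + (-s) by ring, Complex.cpow_add _ _ hNC, Complex.cpow_add _ _ hNC,
      Complex.cpow_one]
    push_cast
    ring
  rw [hsum]
  refine h.congr_fun fun k => ?_
  rw [hN', show -(2 * s + 2 * (k : ℂ) - 1) = (1 - 2 * s) + -((2 * k : ℕ) : ℂ) by push_cast; ring,
    Complex.cpow_add _ _ hNC, Complex.cpow_neg, Complex.cpow_natCast, pow_mul]
  push_cast
  rw [inv_pow]
  ring

lemma tsum_eq_riemannZeta_add_tsum_continuationTerm (hs : 1 < s.re) :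
    ∑' n : ℕ, ((n : ℂ) + 2) * (((n : ℂ) + 1) * ((n : ℂ) + 3)) ^ (-s) =
      riemannZeta (2 * s - 1) - 1 + ∑' k, continuationTerm k s := by
  have hcol (k : ℕ) : ∑' n : ℕ, negBinomCoeff s k * ((n : ℂ) + 2) ^ (-(2 * s + 2 * k - 1)) =
      negBinomCoeff s k * (riemannZeta (2 * s + 2 * k - 1) - 1) := by
    refine ((hasSum_riemannZeta_sub_one ?_).mul_left _).tsum_eq
    simp
    linarith [k.cast_nonneg (α := ℝ)]
  have hsum := (summable_expansion hs).prod_symm.prod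
  simp only [Prod.swap, Function.uncurry, hcol] at hsum
  have hterm (k : ℕ) : continuationTerm k s =
      negBinomCoeff s (k + 1) * (riemannZeta (2 * s + 2 * (k + 1 : ℕ) - 1) - 1) := by
    rw [continuationTerm_eq]
    · push_cast
      ring_nf
    · intro h
      have := congrArg Complex.re h
      simp at this
      linarith [k.cast_nonneg (α := ℝ)]
  simp only [← (hasSum_expansion_term s _).tsum_eq]
  rw [← (summable_expansion hs).tsum_comm]
  simp only [hcol, hterm]
  rw [hsum.tsum_eq_zero_add]
  simp [negBinomCoeff_zero_right]

lemma summable_series (hs : 1 < s.re) :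
    Summable fun n : ℕ => ((n : ℂ) + 2) * (((n : ℂ) + 1) * ((n : ℂ) + 3)) ^ (-s) := by
  simp only [← (hasSum_expansion_term s _).tsum_eq]
  exact (summable_expansion hs).prod

end Expansion

/-- An analytic continuation of the series agrees off its pole with
`ζ(2s - 1) - 1 + ∑ₖ continuationTerm k s`. -/
lemma IsContinuationAt.eventuallyEq_riemannZeta_add_tsum {f : ℂ → ℂ} {s₀ : ℂ}
    (hf : IsContinuationAt
      (fun s => ∑' n : ℕ, ((n : ℂ) + 2) * (((n : ℂ) + 1) * ((n : ℂ) + 3)) ^ (-s)) 1 s₀ f)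
    (hs₀ : s₀ ≠ 1) :
    f =ᶠ[𝓝 s₀] fun s => riemannZeta (2 * s - 1) - 1 + ∑' k, continuationTerm k s := by
  obtain ⟨U, hUo, hUc, h0U, hHU, hfU, hfF⟩ := hf
  let Φ : ℂ → ℂ := fun s => zetaRegular (2 * s - 1) - 1 + ∑' k, continuationTerm k s
  have hΦ : Differentiable ℂ Φ :=
    ((differentiable_zetaRegular.comp (f := fun s : ℂ => 2 * s - 1) (by fun_prop)).sub_const 1).add
      differentiable_tsum_continuationTerm
  have hΦ_eq {s : ℂ} (hs : s ≠ 1) : (s - 1) * Φ s + 1 / 2 =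
      (s - 1) * (riemannZeta (2 * s - 1) - 1 + ∑' k, continuationTerm k s) := by
    have h1 : s - 1 ≠ 0 := sub_ne_zero.2 hs
    have h2 : 2 * s - 1 - 1 = 2 * (s - 1) := by ring
    have h3 : 2 * s - 1 ≠ 1 := by
      rw [← sub_ne_zero, h2]
      exact mul_ne_zero two_ne_zero h1
    simp only [Φ, zetaRegular_of_ne h3, h2]
    field_simp
    ring
  have hEq : Set.EqOn (fun s => (s - 1) * f s) (fun s => (s - 1) * Φ s + 1 / 2) U := by
    refine AnalyticOnNhd.eqOn_of_preconnected_of_eventuallyEq (z₀ := 2)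
      ((AnalyticOnNhd.sub analyticOnNhd_id analyticOnNhd_const).mul hfU) ?_ hUc.isPreconnected
      (hHU (by simp)) ?_
    · exact (Differentiable.differentiableOn (by fun_prop)).analyticOnNhd hUo
    · have h2 : {s : ℂ | 1 < s.re} ∈ 𝓝 (2 : ℂ) :=
        (isOpen_lt continuous_const Complex.continuous_re).mem_nhds (by simp)
      filter_upwards [h2] with s hs
      have hs1 : s ≠ 1 := by rintro rfl; simp at hs
      rw [hΦ_eq hs1, hfF s hs]
      dsimp only
      rw [tsum_eq_riemannZeta_add_tsum_continuationTerm hs]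
  filter_upwards [hUo.mem_nhds h0U, isOpen_ne.mem_nhds hs₀] with s hsU hs1
  exact mul_left_cancel₀ (sub_ne_zero.2 hs1) ((hEq hsU).trans (hΦ_eq hs1))

/-- `z(s) = ∑_{n≥1} (n+1)·(n(n+2))^{-s}` converges absolutely for
`Re s > 1`, and every analytic continuation `f` of the series to `0` satisfies
`f(0) = −7/12` and `f′(0) = 2·ζ′(−1) + log 2 − 1`. -/
theorem stmt7 :
    (∀ s : ℂ, 1 < s.re →
      Summable (fun n : ℕ => ‖((n : ℂ) + 2) * (((n : ℂ) + 1) * ((n : ℂ) + 3)) ^ (-s)‖)) ∧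
    ∀ f : ℂ → ℂ,
      IsContinuationAt
        (fun s => ∑' n : ℕ, ((n : ℂ) + 2) * (((n : ℂ) + 1) * ((n : ℂ) + 3)) ^ (-s)) 1 0 f →
      f 0 = -(7 / 12) ∧
      deriv f 0 = 2 * deriv riemannZeta (-1) + (Real.log 2 : ℂ) - 1 := by
  refine ⟨fun s hs => (summable_series hs).norm, fun f hf => ?_⟩
  have h := hf.eventuallyEq_riemannZeta_add_tsum zero_ne_one
  constructor
  · have hζ : riemannZeta (-1) = -1 / 12 := by
      have := riemannZeta_neg_nat_eq_bernoulli 1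
      norm_num [bernoulli_eq_bernoulli'_of_ne_one] at this
      rw [this]
      norm_num
    rw [h.eq_of_nhds]
    simp only [mul_zero, zero_sub, tsum_continuationTerm_zero, hζ]
    norm_num
  · have hζ : HasDerivAt riemannZeta (deriv riemannZeta (-1)) (2 * 0 - 1) := by
      rw [mul_zero, zero_sub]
      exact (differentiableAt_riemannZeta (by norm_num)).hasDerivAt
    have hlin : HasDerivAt (fun s : ℂ => 2 * s - 1) 2 0 := by
      simpa using ((hasDerivAt_id' (0 : ℂ)).const_mul 2).sub_const 1
    have hd := ((hζ.comp 0 hlin).sub_const 1).add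
      (differentiable_tsum_continuationTerm 0).hasDerivAt
    rw [h.deriv_eq]
    refine hd.deriv.trans ?_
    rw [deriv_tsum_continuationTerm_zero]
    ring
end

section
/- Let a ≥ 1 be a real number. The double series Z(s) = ∑_{m=1}^∞ ∑_{n=1}^∞ ((a m + n − 1/2)² − 1/4)^{-s} (whose general term equals ((a m + n)(a m + n − 1))^{-s}) converges absolutely for Re(s) > 2, and every analytic continuation f of this series to the point 0 satisfies f(0) = a/12 + 1/(12a). -/
theorem hasSum_choose_mul_pow (w : ℂ) {z : ℂ} (hz : ‖z‖ < 1) :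
    HasSum (fun n : ℕ => Ring.choose w n * z ^ n) ((1 + z) ^ w) := by
  have h := (Complex.one_add_cpow_hasFPowerSeriesOnBall_zero (a := w)).hasSum (y := z)
    (by simpa [Metric.eball, edist_eq_enorm_sub, enorm_eq_nnnorm, ← NNReal.coe_lt_one] using hz)
  simpa [binomialSeries, mul_comm] using h

/-- The `n`-th Taylor coefficient in `u` of `(1 - u / 2) ^ w - (1 + u / 2) ^ w`. -/
noncomputable def diffCoeff (w : ℂ) (n : ℕ) : ℂ :=
  Ring.choose w n * ((-1 / 2) ^ n - (1 / 2) ^ n)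

/-- The `n`-th Taylor coefficient in `u` of `(1 - u ^ 2 / 4) ^ (-s)`. -/
noncomputable def termCoeff (s : ℂ) (n : ℕ) : ℂ :=
  if Even n then Ring.choose (-s) (n / 2) * (-1 / 4) ^ (n / 2) else 0

/-- The coefficients of the formal solution `E = ∑ j, solCoeff s j * x ^ (1 - 2 * s - j)` of
the difference equation `E (x - 1 / 2) - E (x + 1 / 2) = (x ^ 2 - 1 / 4) ^ (-s)`. -/
noncomputable def solCoeff (s : ℂ) : ℕ → ℂ
  | n => (termCoeff s n - ∑ j : Fin n, solCoeff s j * diffCoeff (1 - 2 * s - (j : ℕ)) (n + 1 - j)) /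
    (2 * s + n - 1)

/-- The defect of the truncated formal solution, in the variable `u = 1 / x`. -/
noncomputable def solDefect (K : ℕ) (s u : ℂ) : ℂ :=
  u * (1 - u ^ 2 / 4) ^ (-s) - ∑ j ∈ Finset.range K,
    solCoeff s j * (u ^ j * ((1 - u / 2) ^ (1 - 2 * s - j) - (1 + u / 2) ^ (1 - 2 * s - j)))

theorem hasSum_diffCoeff (w : ℂ) {u : ℂ} (hu : ‖u‖ < 1) :
    HasSum (fun n : ℕ => diffCoeff w n * u ^ n) ((1 - u / 2) ^ w - (1 + u / 2) ^ w) := by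
  have h1 := hasSum_choose_mul_pow w (z := -u / 2) (by simp; linarith)
  have h2 := hasSum_choose_mul_pow w (z := u / 2) (by simp; linarith)
  convert! h1.sub h2 using 1
  · funext n
    rw [diffCoeff, show -u / 2 = (-1 / 2) * u by ring, show u / 2 = (1 / 2) * u by ring,
      mul_pow, mul_pow]
    ring
  · rw [neg_div, ← sub_eq_add_neg]

theorem hasSum_termCoeff (s : ℂ) {u : ℂ} (hu : ‖u‖ < 1) :
    HasSum (fun n : ℕ => termCoeff s n * u ^ n) ((1 - u ^ 2 / 4) ^ (-s)) := by
  have h1 := hasSum_choose_mul_pow (-s) (z := -u ^ 2 / 4)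
    (by simp; nlinarith [norm_nonneg u])
  have hinj : Function.Injective (fun k : ℕ => 2 * k) := fun a b h => by simpa using h
  rw [← hinj.hasSum_iff]
  · convert! h1 using 1
    · funext k
      simp only [Function.comp, termCoeff, even_two_mul, if_true,
        Nat.mul_div_cancel_left k two_pos]
      rw [show -u ^ 2 / 4 = (-1 / 4) * u ^ 2 by ring, mul_pow, ← pow_mul]
      ring
    · ring_nf
  · intro n hn
    have : ¬ Even n := fun ⟨k, hk⟩ => hn ⟨k, by simp; omega⟩
    simp [termCoeff, this]

theorem hasSum_shift {a : ℕ → ℂ} {u A : ℂ} (h : HasSum (fun n => a n * u ^ n) A) (j : ℕ) :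
    HasSum (fun n => (if j ≤ n then a (n - j) else 0) * u ^ n) (u ^ j * A) := by
  rw [← (add_left_injective j).hasSum_iff]
  · convert! h.mul_left (u ^ j) using 1
    funext n
    simp [pow_add]
    ring
  · intro n hn
    have : ¬ j ≤ n := fun hj => hn ⟨n - j, by simp; omega⟩
    simp [this]

theorem diffCoeff_zero (w : ℂ) : diffCoeff w 0 = 0 := by simp [diffCoeff]

theorem diffCoeff_one (w : ℂ) : diffCoeff w 1 = -w := by
  simp [diffCoeff]; ring

theorem solCoeff_one (s : ℂ) : solCoeff s 1 = 0 := by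
  rw [solCoeff]
  norm_num [termCoeff, diffCoeff]

theorem sum_solCoeff_mul {s : ℂ} {n : ℕ} (h : 2 * s + n - 1 ≠ 0 ∨ n = 1) :
    ∑ j ∈ Finset.range (n + 1), solCoeff s j * diffCoeff (1 - 2 * s - j) (n + 1 - j) =
      termCoeff s n := by
  rw [Finset.sum_range_succ, Nat.add_sub_cancel_left, diffCoeff_one]
  have hn : solCoeff s n * (2 * s + n - 1) = termCoeff s n -
      ∑ j ∈ Finset.range n, solCoeff s j * diffCoeff (1 - 2 * s - j) (n + 1 - j) := by
    rcases h with h | rfl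
    · rw [solCoeff, Finset.sum_range]
      exact div_mul_cancel₀ _ h
    · norm_num [solCoeff_one, termCoeff, diffCoeff]
  linear_combination hn

theorem solDefect_isBigO {K : ℕ} {s : ℂ}
    (h : ∀ n < K, 2 * s + n - 1 ≠ 0 ∨ n = 1) :
    (solDefect K s) =O[nhds 0] fun u => ‖u‖ ^ (K + 1) := by
  let a : ℕ → ℂ := fun n => (if 1 ≤ n then termCoeff s (n - 1) else 0) -
    ∑ j ∈ Finset.range K, solCoeff s j *
      (if j ≤ n then diffCoeff (1 - 2 * s - j) (n - j) else 0)
  have hsum : ∀ u : ℂ, ‖u‖ < 1 → HasSum (fun n => a n * u ^ n) (solDefect K s u) := by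
    intro u hu
    have h1 := hasSum_shift (hasSum_termCoeff s hu) 1
    have h2 := hasSum_sum (s := Finset.range K) fun j _ =>
      (hasSum_shift (hasSum_diffCoeff (1 - 2 * s - j) hu) j).mul_left (solCoeff s j)
    convert! h1.sub h2 using 1
    · funext n
      simp only [a, sub_mul, Finset.sum_mul, mul_assoc]
    · rw [solDefect, pow_one]
  have ha : ∀ n ≤ K, a n = 0 := by
    rintro (_ | n) hn
    · simp only [a, nonpos_iff_eq_zero, one_ne_zero, if_false, zero_sub, neg_eq_zero]
      refine Finset.sum_eq_zero fun j _ => ?_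
      split_ifs with hj <;> simp [diffCoeff_zero]
    · simp only [a, le_add_iff_nonneg_left, zero_le, if_true, Nat.add_sub_cancel]
      rw [sub_eq_zero, ← sum_solCoeff_mul (h n hn)]
      symm
      rw [← Finset.sum_subset (Finset.range_subset_range.2 hn)]
      · refine Finset.sum_congr rfl fun j hj => ?_
        rw [if_pos (Finset.mem_range.1 hj).le]
      · intro j _ hj
        rw [Finset.mem_range, not_lt] at hj
        split_ifs with hj'
        · simp [le_antisymm hj hj', diffCoeff_zero]
        · simp
  have hfps : HasFPowerSeriesAt (solDefect K s) (FormalMultilinearSeries.ofScalars ℂ a) 0 := by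
    rw [hasFPowerSeriesAt_iff]
    filter_upwards [Metric.ball_mem_nhds (0 : ℂ) one_pos] with u hu
    simpa [mul_comm] using hsum u (by simpa using hu)
  have := hfps.isBigO_sub_partialSum_pow (K + 1)
  have h0 : ∀ u, (FormalMultilinearSeries.ofScalars ℂ a).partialSum (K + 1) u = 0 := by
    intro u
    refine Finset.sum_eq_zero fun n hn => ?_
    simp [ha n (by simpa [Nat.lt_succ_iff] using hn)]
  simpa [h0] using this

theorem choose_eq_aeval (w : ℂ) (n : ℕ) :
    Ring.choose w n = (n.factorial : ℂ)⁻¹ * Polynomial.aeval w (descPochhammer ℤ n) := by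
  rw [Ring.choose_eq_smul, Polynomial.aeval_eq_smeval, smul_eq_mul]

theorem differentiable_choose (n : ℕ) : Differentiable ℂ fun w : ℂ => Ring.choose w n := by
  simp_rw [choose_eq_aeval, Polynomial.aeval_def, Polynomial.eval₂_eq_eval_map]
  exact (Polynomial.differentiable _).const_mul _

theorem differentiableAt_solCoeff {s : ℂ} (n : ℕ) (h : ∀ j ≤ n, 2 * s + j - 1 ≠ 0 ∨ j = 1) :
    DifferentiableAt ℂ (fun z => solCoeff z n) s := by
  induction n using Nat.strong_induction_on with
  | _ n ih =>
    rcases h n le_rfl with hn | rfl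
    · have hsum : DifferentiableAt ℂ (fun z => ∑ j : Fin n, solCoeff z j *
          diffCoeff (1 - 2 * z - (j : ℕ)) (n + 1 - j)) s := by
        refine DifferentiableAt.fun_sum fun j _ => (ih j j.2 fun i hi => h i (by omega)).mul ?_
        simp only [diffCoeff]
        refine DifferentiableAt.mul_const ?_ _
        exact (differentiable_choose _).differentiableAt.comp s
          (f := fun z : ℂ => 1 - 2 * z - (j : ℕ)) (by fun_prop)
      have hterm : DifferentiableAt ℂ (fun z => termCoeff z n) s := by
        unfold termCoeff
        split_ifs
        · refine DifferentiableAt.mul_const ?_ _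
          exact (differentiable_choose _).differentiableAt.comp s
            (f := fun z : ℂ => -z) (by fun_prop)
        · fun_prop
      have : (fun z => solCoeff z n) = fun z => (termCoeff z n - ∑ j : Fin n, solCoeff z j *
          diffCoeff (1 - 2 * z - (j : ℕ)) (n + 1 - j)) / (2 * z + n - 1) := by
        funext z
        rw [solCoeff]
      rw [this]
      exact (hterm.sub hsum).div (by fun_prop) hn
    · simp only [solCoeff_one]
      fun_prop

theorem solCoeff_zero (s : ℂ) : solCoeff s 0 = 1 / (2 * s - 1) := by
  rw [solCoeff]
  simp [termCoeff]

theorem solCoeff_two {s : ℂ} (h : 2 * s - 1 ≠ 0) :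
    solCoeff s 2 = (s / 4 - s * (2 * s + 1) / 12) / (2 * s + 1) := by
  have hc : Ring.choose (1 - 2 * s) 3 = (1 - 2 * s) * (-2 * s) * (-2 * s - 1) / 6 := by
    rw [choose_eq_aeval]
    simp [descPochhammer_succ_right, Nat.factorial, map_ofNat (Polynomial.aeval (1 - 2 * s)) 2]
    ring
  rw [solCoeff, Fin.sum_univ_two]
  norm_num [solCoeff_one, solCoeff_zero, termCoeff, diffCoeff, hc]
  rw [show 2 * s + 2 - 1 = 2 * s + 1 by ring]
  congr 1
  have hi : (2 * s - 1)⁻¹ * (2 * s - 1) = 1 := inv_mul_cancel₀ h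
  linear_combination (-s * (1 + 2 * s) / 12) * hi

theorem solCoeff_at_zero {n : ℕ} (hn : n ≠ 0) : solCoeff 0 n = 0 := by
  induction n using Nat.strong_induction_on with
  | _ n ih =>
    rw [solCoeff, Finset.sum_eq_zero, sub_zero, termCoeff]
    · split_ifs with he
      · obtain ⟨k, rfl⟩ := he
        rw [neg_zero, Ring.choose_zero_pos ℂ (by omega)]
        simp
      · simp
    · intro j _
      rcases eq_or_ne (j : ℕ) 0 with hj | hj
      · have := Ring.choose_natCast (R := ℂ) 1 (n + 1)
        rw [Nat.choose_eq_zero_of_lt (by omega), Nat.cast_one] at this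
        simp [hj, diffCoeff, this]
      · rw [ih j j.2 hj, zero_mul]

theorem one_add_half_mem_slitPlane {u : ℂ} (hu : ‖u‖ ≤ 1) : 1 + u / 2 ∈ Complex.slitPlane :=
  Complex.mem_slitPlane_of_norm_lt_one (by simp; linarith)

theorem one_sub_half_mem_slitPlane {u : ℂ} (hu : ‖u‖ ≤ 1) : 1 - u / 2 ∈ Complex.slitPlane := by
  simpa [sub_eq_add_neg, neg_div] using one_add_half_mem_slitPlane (u := -u) (by simpa)

theorem one_sub_sq_mem_slitPlane {u : ℂ} (hu : ‖u‖ ≤ 1) : 1 - u ^ 2 / 4 ∈ Complex.slitPlane := by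
  rw [sub_eq_add_neg]
  exact Complex.mem_slitPlane_of_norm_lt_one (by simp; nlinarith [norm_nonneg u])

/-- A set on which the first `K` coefficients have no poles. -/
def regularSet (K : ℕ) : Set ℂ := {s | ∀ n < K, 2 * s + n - 1 ≠ 0 ∨ n = 1}

theorem isOpen_regularSet (K : ℕ) : IsOpen (regularSet K) := by
  have : regularSet K = ⋂ n ∈ Finset.range K, {s : ℂ | 2 * s + n - 1 ≠ 0 ∨ n = 1} := by
    ext s
    simp [regularSet]
  rw [this]
  refine isOpen_biInter_finset fun n _ => ?_
  exact (isOpen_ne_fun (by fun_prop) (by fun_prop)).union isOpen_const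

theorem continuousOn_solDefect (K : ℕ) :
    ContinuousOn (fun p : ℂ × ℂ => solDefect K p.1 p.2)
      (regularSet K ×ˢ Metric.closedBall 0 1) := by
  rintro ⟨s, v⟩ ⟨hs, hv⟩
  have hv' : ‖v‖ ≤ 1 := by simpa using hv
  have h1 := one_sub_half_mem_slitPlane hv'
  have h2 := one_add_half_mem_slitPlane hv'
  have h3 := one_sub_sq_mem_slitPlane hv'
  refine ContinuousAt.continuousWithinAt ?_
  unfold solDefect
  refine (continuousAt_snd.mul (.cpow (by fun_prop) (by fun_prop) h3)).sub
    (tendsto_finsetSum _ fun j hj => ContinuousAt.mul ?_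
      (.mul (by fun_prop) (.sub ?_ ?_)))
  · refine ContinuousAt.comp (f := Prod.fst) (g := fun z => solCoeff z j) ?_ continuousAt_fst
    exact (differentiableAt_solCoeff j fun i hi =>
      hs i (hi.trans_lt (Finset.mem_range.1 hj))).continuousAt
  · exact .cpow (by fun_prop) (by fun_prop) h1
  · exact .cpow (by fun_prop) (by fun_prop) h2

theorem norm_solDefect_le {K : ℕ} {s u : ℂ} {M : ℝ}
    (h : s ∈ regularSet K)
    (hM : ∀ u : ℂ, ‖u‖ ≤ 1 → ‖solDefect K s u‖ ≤ M) (hu : ‖u‖ < 1) :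
    ‖solDefect K s u‖ ≤ M * ‖u‖ ^ (K + 1) := by
  have h0 : solDefect K s 0 = 0 := by
    simp [solDefect]
  have hd : DifferentiableOn ℂ (solDefect K s) (Metric.ball 0 1) := by
    intro v hv
    have hv' : ‖v‖ ≤ 1 := by simpa using (Metric.mem_ball.1 hv).le
    have h1 := one_sub_half_mem_slitPlane hv'
    have h2 := one_add_half_mem_slitPlane hv'
    have h3 := one_sub_sq_mem_slitPlane hv'
    have d1 (w : ℂ) : DifferentiableAt ℂ (fun v : ℂ => (1 - v / 2) ^ w) v :=
      .cpow (by fun_prop) (by fun_prop) h1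
    have d2 (w : ℂ) : DifferentiableAt ℂ (fun v : ℂ => (1 + v / 2) ^ w) v :=
      .cpow (by fun_prop) (by fun_prop) h2
    have d3 (w : ℂ) : DifferentiableAt ℂ (fun v : ℂ => (1 - v ^ 2 / 4) ^ w) v :=
      .cpow (by fun_prop) (by fun_prop) h3
    refine DifferentiableAt.differentiableWithinAt ?_
    unfold solDefect
    fun_prop
  have := Complex.dist_le_mul_div_pow_of_mapsTo_ball_of_isLittleO (f := solDefect K s) (c := 0)
    (z := u) (R₁ := 1) (R₂ := M) (n := K) hd
    (fun v hv => by simpa [h0] using hM v (by simpa using (Metric.mem_ball.1 hv).le))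
    (by
      simp only [h0, sub_zero]
      refine (solDefect_isBigO h).trans_isLittleO ?_
      exact (Asymptotics.isLittleO_pow_pow (𝕜 := ℝ) (Nat.lt_succ_self K)).comp_tendsto
        (tendsto_norm_zero (E := ℂ)))
    (by simpa using hu)
  simpa [h0] using this

theorem exists_norm_solDefect_le {K : ℕ} {t : Set ℂ} (ht : IsCompact t)
    (htK : t ⊆ regularSet K) :
    ∃ M, 0 ≤ M ∧ ∀ s ∈ t, ∀ u : ℂ, ‖u‖ < 1 → ‖solDefect K s u‖ ≤ M * ‖u‖ ^ (K + 1) := by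
  obtain ⟨M, hM⟩ := (ht.prod (isCompact_closedBall (0 : ℂ) 1)).exists_bound_of_continuousOn
    ((continuousOn_solDefect K).mono (Set.prod_mono_left htK))
  refine ⟨max M 0, le_max_right _ _, fun s hs u hu => norm_solDefect_le (htK hs) ?_ hu⟩
  exact fun v hv => (hM (s, v) ⟨hs, by simpa using hv⟩).trans (le_max_left _ _)

/-- The truncated solution `∑ j < K, solCoeff s j * y ^ (1 - 2 * s - j)` of the difference
equation. -/
noncomputable def truncSol (K : ℕ) (s : ℂ) (y : ℝ) : ℂ :=
  ∑ j ∈ Finset.range K, solCoeff s j * (y : ℂ) ^ (1 - 2 * s - j)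

/-- The defect of `truncSol` in the difference equation. -/
noncomputable def truncDefect (K : ℕ) (s : ℂ) (x : ℝ) : ℂ :=
  ((x : ℂ) ^ 2 - 1 / 4) ^ (-s) - (truncSol K s (x - 1 / 2) - truncSol K s (x + 1 / 2))

theorem truncDefect_eq (K : ℕ) (s : ℂ) {x : ℝ} (hx : 1 < x) :
    truncDefect K s x = (x : ℂ) ^ (-2 * s) * x * solDefect K s (1 / x : ℝ) := by
  have hx0 : (0 : ℝ) < x := by linarith
  have hxc : (x : ℂ) ≠ 0 := by exact_mod_cast hx0.ne'
  have hu : 1 / x < 1 := by rw [div_lt_one hx0]; exact hx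
  have hu0 : 0 < 1 / x := by positivity
  have h1 : ((x : ℂ) ^ 2 - 1 / 4) ^ (-s) =
      (x : ℂ) ^ (-2 * s) * (1 - ((1 / x : ℝ) : ℂ) ^ 2 / 4) ^ (-s) := by
    have : (x : ℂ) ^ 2 - 1 / 4 = ((x * x : ℝ) : ℂ) * ((1 - (1 / x) ^ 2 / 4 : ℝ) : ℂ) := by
      push_cast
      field_simp
    rw [this, Complex.mul_cpow_ofReal_nonneg (by positivity) (by nlinarith), Complex.ofReal_mul,
      Complex.mul_cpow_ofReal_nonneg hx0.le hx0.le, ← Complex.cpow_add _ _ hxc]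
    push_cast
    ring_nf
  have h2 (j : ℕ) : (x : ℂ) ^ (1 - 2 * s - j) =
      (x : ℂ) ^ (-2 * s) * x * ((1 / x : ℝ) : ℂ) ^ j := by
    rw [show 1 - 2 * s - (j : ℂ) = -2 * s + 1 - j by ring, Complex.cpow_sub _ _ hxc,
      Complex.cpow_add _ _ hxc, Complex.cpow_natCast, Complex.cpow_one]
    push_cast
    rw [div_pow, one_pow, div_eq_mul_one_div]
  have h3 (w : ℂ) : (((x - 1 / 2 : ℝ) : ℂ)) ^ w =
      (x : ℂ) ^ w * (1 - ((1 / x : ℝ) : ℂ) / 2) ^ w := by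
    have : ((x - 1 / 2 : ℝ) : ℂ) = (x : ℂ) * ((1 - 1 / x / 2 : ℝ) : ℂ) := by
      push_cast
      field_simp
    rw [this, Complex.mul_cpow_ofReal_nonneg hx0.le (by linarith)]
    push_cast
    rfl
  have h4 (w : ℂ) : (((x + 1 / 2 : ℝ) : ℂ)) ^ w =
      (x : ℂ) ^ w * (1 + ((1 / x : ℝ) : ℂ) / 2) ^ w := by
    have : ((x + 1 / 2 : ℝ) : ℂ) = (x : ℂ) * ((1 + 1 / x / 2 : ℝ) : ℂ) := by
      push_cast
      field_simp
    rw [this, Complex.mul_cpow_ofReal_nonneg hx0.le (by linarith)]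
    push_cast
    rfl
  have h5 : (x : ℂ) * ((1 / x : ℝ) : ℂ) = 1 := by
    push_cast
    field_simp
  rw [truncDefect, solDefect, h1, truncSol, truncSol, ← Finset.sum_sub_distrib, mul_sub,
    Finset.mul_sum]
  congr 1
  · linear_combination (-(x : ℂ) ^ (-2 * s) * (1 - ((1 / x : ℝ) : ℂ) ^ 2 / 4) ^ (-s)) * h5
  · refine Finset.sum_congr rfl fun j _ => ?_
    rw [h3, h4, h2]
    ring

theorem exists_norm_truncDefect_le {K : ℕ} {t : Set ℂ} (ht : IsCompact t)
    (htK : t ⊆ regularSet K) :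
    ∃ M, 0 ≤ M ∧ ∀ s ∈ t, ∀ x : ℝ, 1 < x →
      ‖truncDefect K s x‖ ≤ M * x ^ (-(2 * s.re + K)) := by
  obtain ⟨M, hM0, hM⟩ := exists_norm_solDefect_le ht htK
  refine ⟨M, hM0, fun s hs x hx => ?_⟩
  have hx0 : (0 : ℝ) < x := by linarith
  have hu : ‖((1 / x : ℝ) : ℂ)‖ = 1 / x := by
    rw [Complex.norm_real, Real.norm_of_nonneg (by positivity)]
  have h := hM s hs (1 / x : ℝ) (by rw [hu, div_lt_one hx0]; exact hx)
  rw [hu] at h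
  rw [truncDefect_eq K s hx, norm_mul, norm_mul, Complex.norm_cpow_eq_rpow_re_of_pos hx0,
    Complex.norm_real, Real.norm_of_nonneg hx0.le]
  refine (mul_le_mul_of_nonneg_left h (by positivity)).trans_eq ?_
  rw [neg_add, Real.rpow_add hx0, Real.rpow_neg hx0.le (K : ℝ), Real.rpow_natCast,
    show (-2 * s).re = -(2 * s.re) by simp, pow_succ, one_div, inv_pow]
  field_simp

theorem differentiableOn_truncDefect (K : ℕ) {x : ℝ} (hx : 1 < x) :
    DifferentiableOn ℂ (fun s => truncDefect K s x) (regularSet K) := by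
  intro s hs
  refine DifferentiableAt.differentiableWithinAt ?_
  have hc (j : ℕ) (hj : j ∈ Finset.range K) : DifferentiableAt ℂ (fun z => solCoeff z j) s :=
    differentiableAt_solCoeff j fun i hi => hs i (hi.trans_lt (Finset.mem_range.1 hj))
  have hp {y : ℂ} (hy : y ≠ 0) (g : ℂ → ℂ) (hg : DifferentiableAt ℂ g s) :
      DifferentiableAt ℂ (fun z => y ^ g z) s := hg.const_cpow (.inl hy)
  have hsol {y : ℝ} (hy : 0 < y) : DifferentiableAt ℂ (fun z => truncSol K z y) s :=
    DifferentiableAt.fun_sum fun j hj =>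
      (hc j hj).mul (hp (by exact_mod_cast hy.ne') _ (by fun_prop))
  have h1 : (x : ℂ) ^ 2 - 1 / 4 ≠ 0 := by
    have : (x ^ 2 - 1 / 4 : ℝ) ≠ 0 := by nlinarith
    rw [← Complex.ofReal_ne_zero] at this
    simpa using this
  exact (hp h1 _ (by fun_prop)).sub ((hsol (by linarith)).sub (hsol (by linarith)))

/-- The abscissae `a * m + n - 1 / 2`, for `m, n ≥ 1`. -/
noncomputable def lat (a : ℝ) (p : ℕ × ℕ) : ℝ := a * (p.1 + 1) + p.2 + 1 / 2

theorem succ_add_le_lat {a : ℝ} (ha : 1 ≤ a) (p : ℕ × ℕ) :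
    (p.1 : ℝ) + 1 + p.2 + 1 / 2 ≤ lat a p := by
  rw [lat]
  nlinarith [(Nat.cast_nonneg p.1 : (0 : ℝ) ≤ p.1)]

theorem one_lt_lat {a : ℝ} (ha : 1 ≤ a) (p : ℕ × ℕ) : 1 < lat a p := by
  have := succ_add_le_lat ha p
  have h1 : (0 : ℝ) ≤ p.1 := Nat.cast_nonneg _
  have h2 : (0 : ℝ) ≤ p.2 := Nat.cast_nonneg _
  linarith

theorem mul_succ_le_lat_sq_sub {a : ℝ} (ha : 1 ≤ a) (p : ℕ × ℕ) :
    ((p.1 : ℝ) + 1) * (p.2 + 1) ≤ lat a p ^ 2 - 1 / 4 := by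
  have := succ_add_le_lat ha p
  have h1 : (0 : ℝ) ≤ p.1 := Nat.cast_nonneg _
  have h2 : (0 : ℝ) ≤ p.2 := Nat.cast_nonneg _
  nlinarith [mul_nonneg h1 h2]

theorem summable_mul_succ_rpow {σ : ℝ} (hσ : 1 < σ) :
    Summable fun p : ℕ × ℕ => (((p.1 : ℝ) + 1) * (p.2 + 1)) ^ (-σ) := by
  have h : Summable fun n : ℕ => ((n : ℝ) + 1) ^ (-σ) := by
    have := (summable_nat_add_iff 1).2 (Real.summable_nat_rpow.2 (neg_lt_neg hσ))
    simpa using this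
  convert! h.mul_of_nonneg h (fun n => by positivity) (fun n => by positivity) using 2 with p
  exact Real.mul_rpow (by positivity) (by positivity)

theorem summable_lat_rpow {a : ℝ} (ha : 1 ≤ a) {σ : ℝ} (hσ : 2 < σ) :
    Summable fun p : ℕ × ℕ => lat a p ^ (-σ) := by
  refine (summable_mul_succ_rpow (σ := σ / 2) (by linarith)).of_nonneg_of_le
    (fun p => Real.rpow_nonneg (by linarith [one_lt_lat ha p]) _) fun p => ?_
  have h0 : 0 ≤ lat a p := by linarith [one_lt_lat ha p]
  have : lat a p ^ (-σ) = (lat a p ^ 2) ^ (-(σ / 2)) := by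
    rw [← Real.rpow_natCast, ← Real.rpow_mul h0]
    congr 1
    push_cast
    ring
  rw [this]
  exact Real.rpow_le_rpow_of_nonpos (by positivity)
    (by linarith [mul_succ_le_lat_sq_sub ha p]) (by linarith)

theorem summable_norm_term {a : ℝ} (ha : 1 ≤ a) {s : ℂ} (hs : 1 < s.re) :
    Summable fun p : ℕ × ℕ => ‖((lat a p : ℂ) ^ 2 - 1 / 4) ^ (-s)‖ := by
  refine (summable_mul_succ_rpow hs).of_nonneg_of_le (fun p => norm_nonneg _) fun p => ?_
  have h1 := mul_succ_le_lat_sq_sub ha p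
  have h2 : (0 : ℝ) < ((p.1 : ℝ) + 1) * (p.2 + 1) := by positivity
  have : (lat a p : ℂ) ^ 2 - 1 / 4 = ((lat a p ^ 2 - 1 / 4 : ℝ) : ℂ) := by push_cast; rfl
  rw [this, Complex.norm_cpow_eq_rpow_re_of_pos (h2.trans_le h1), Complex.neg_re]
  exact Real.rpow_le_rpow_of_nonpos h2 h1 (by linarith)

/-- The total defect over the lattice, which converges for `1 - K / 2 < re s`. -/
noncomputable def defectSum (a : ℝ) (K : ℕ) (s : ℂ) : ℂ := ∑' p : ℕ × ℕ, truncDefect K s (lat a p)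

theorem summable_truncDefect {a : ℝ} (ha : 1 ≤ a) {K : ℕ} {s : ℂ} (hs : s ∈ regularSet K)
    (hsK : 2 < 2 * s.re + K) : Summable fun p : ℕ × ℕ => truncDefect K s (lat a p) := by
  obtain ⟨M, -, hM⟩ := exists_norm_truncDefect_le (isCompact_singleton (x := s))
    (Set.singleton_subset_iff.2 hs)
  exact .of_norm_bounded ((summable_lat_rpow ha hsK).mul_left M)
    fun p => hM s rfl _ (one_lt_lat ha p)

theorem differentiableOn_defectSum {a : ℝ} (ha : 1 ≤ a) (K : ℕ) :
    DifferentiableOn ℂ (defectSum a K) (regularSet K ∩ {s | 2 < 2 * s.re + K}) := by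
  rintro s ⟨hs, hsK⟩
  rw [Set.mem_ofPred_eq] at hsK
  obtain ⟨σ, hσ2, hσ⟩ := exists_between hsK
  have hopen : IsOpen (regularSet K ∩ {s : ℂ | σ < 2 * s.re + K}) :=
    (isOpen_regularSet K).inter (isOpen_lt (by fun_prop) (by fun_prop))
  obtain ⟨t, ht, hst, htK⟩ := exists_compact_subset hopen ⟨hs, hσ⟩
  obtain ⟨M, hM0, hM⟩ := exists_norm_truncDefect_le ht (htK.trans Set.inter_subset_left)
  refine DifferentiableAt.differentiableWithinAt
    (DifferentiableOn.differentiableAt (s := interior t) ?_ (isOpen_interior.mem_nhds hst))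
  refine Complex.differentiableOn_tsum_of_summable_norm
    ((summable_lat_rpow ha hσ2).mul_left M) (fun p => ?_) isOpen_interior fun p w hw => ?_
  · exact (differentiableOn_truncDefect K (one_lt_lat ha p)).mono
      (interior_subset.trans (htK.trans Set.inter_subset_left))
  · refine (hM w (interior_subset hw) _ (one_lt_lat ha p)).trans
      (mul_le_mul_of_nonneg_left ?_ hM0)
    have := (htK (interior_subset hw)).2
    rw [Set.mem_ofPred_eq] at this
    exact Real.rpow_le_rpow_of_exponent_le (one_lt_lat ha p).le (by linarith)

theorem tendsto_truncSol_add_natCast (K : ℕ) {s : ℂ} (hs : 1 / 2 < s.re) (y : ℝ) :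
    Filter.Tendsto (fun n : ℕ => truncSol K s (y + n)) Filter.atTop (nhds 0) := by
  have hy : Filter.Tendsto (fun n : ℕ => y + (n : ℝ)) Filter.atTop Filter.atTop :=
    Filter.tendsto_atTop_add_const_left _ _ tendsto_natCast_atTop_atTop
  have : Filter.Tendsto (truncSol K s) Filter.atTop (nhds 0) := by
    rw [show (0 : ℂ) = ∑ j ∈ Finset.range K, solCoeff s j * 0 by simp]
    refine tendsto_finsetSum _ fun j _ => Filter.Tendsto.const_mul _ ?_
    rw [tendsto_zero_iff_norm_tendsto_zero]
    have hj : (0 : ℝ) ≤ j := Nat.cast_nonneg j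
    refine (tendsto_rpow_neg_atTop (y := 2 * s.re + j - 1) (by linarith)).congr' ?_
    filter_upwards [Filter.eventually_gt_atTop 0] with x hx
    rw [Complex.norm_cpow_eq_rpow_re_of_pos hx]
    congr 1
    simp
    ring
  exact this.comp hy

theorem hasSum_truncSol {a : ℝ} (ha : 1 ≤ a) (K : ℕ) {s : ℂ} (hs : 1 < s.re) :
    HasSum (fun m : ℕ => truncSol K s (a * (m + 1)))
      (∑ j ∈ Finset.range K,
        solCoeff s j * (a : ℂ) ^ (1 - 2 * s - j) * riemannZeta (2 * s + j - 1)) := by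
  refine hasSum_sum fun j _ => ?_
  have hj : (0 : ℝ) ≤ j := Nat.cast_nonneg j
  have hre : 1 < (2 * s + j - 1 : ℂ).re := by
    simp
    linarith
  have h : HasSum (fun n : ℕ => 1 / (n + 1 : ℂ) ^ (2 * s + j - 1))
      (riemannZeta (2 * s + j - 1)) := by
    rw [zeta_eq_tsum_one_div_nat_add_one_cpow hre]
    have := (summable_nat_add_iff 1).2 (Complex.summable_one_div_nat_cpow.2 hre)
    exact Summable.hasSum (by simpa using this)
  convert! h.mul_left (solCoeff s j * (a : ℂ) ^ (1 - 2 * s - j)) using 2 with m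
  rw [mul_assoc]
  congr 1
  rw [Complex.ofReal_mul, Complex.mul_cpow_ofReal_nonneg (by linarith) (by positivity), one_div,
    ← Complex.cpow_neg]
  push_cast
  ring_nf

theorem tsum_term_eq {a : ℝ} (ha : 1 ≤ a) {K : ℕ} {s : ℂ} (hs : 1 < s.re)
    (hsK : s ∈ regularSet K) :
    ∑' (m : ℕ) (n : ℕ), ((lat a (m, n) : ℂ) ^ 2 - 1 / 4) ^ (-s) =
      ∑ j ∈ Finset.range K,
        solCoeff s j * (a : ℂ) ^ (1 - 2 * s - j) * riemannZeta (2 * s + j - 1) +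
        defectSum a K s := by
  have hK : (0 : ℝ) ≤ K := Nat.cast_nonneg K
  have hT := (summable_norm_term ha hs).of_norm
  have hR := summable_truncDefect ha hsK (by linarith)
  have hinner (m : ℕ) : ∑' n : ℕ, ((lat a (m, n) : ℂ) ^ 2 - 1 / 4) ^ (-s) =
      truncSol K s (a * (m + 1)) + ∑' n : ℕ, truncDefect K s (lat a (m, n)) := by
    have hTm := hT.prod_factor m
    have hRm := hR.prod_factor m
    have hD := (hTm.sub hRm).hasSum.tendsto_sum_nat
    have hpart (N : ℕ) : ∑ n ∈ Finset.range N, (((lat a (m, n) : ℂ) ^ 2 - 1 / 4) ^ (-s) -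
        truncDefect K s (lat a (m, n))) =
        truncSol K s (a * (m + 1)) - truncSol K s (a * (m + 1) + N) := by
      have := Finset.sum_range_sub' (fun n : ℕ => truncSol K s (a * (m + 1) + n)) N
      rw [Nat.cast_zero, add_zero] at this
      rw [← this]
      refine Finset.sum_congr rfl fun n _ => ?_
      rw [truncDefect, sub_sub_cancel, lat]
      push_cast
      congr 2 <;> ring
    simp only [hpart] at hD
    have hlim := tendsto_const_nhds (x := truncSol K s (a * (m + 1))).sub
      (tendsto_truncSol_add_natCast K (s := s) (by linarith) (a * (m + 1)))
    have := tendsto_nhds_unique hD hlim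
    rw [hTm.tsum_sub hRm, sub_zero] at this
    exact sub_eq_iff_eq_add.1 this
  simp only [hinner]
  have hE := hasSum_truncSol ha K hs
  rw [hE.summable.tsum_add hR.prod, hE.tsum_eq, defectSum, hR.tsum_prod]

theorem isPreconnected_ball_diff_singleton (z : ℂ) (r : ℝ) :
    IsPreconnected (Metric.ball z r \ {z}) := by
  rcases le_or_gt r 0 with hr | hr
  · simp [Metric.ball_eq_empty.2 hr, isPreconnected_empty]
  have : Metric.ball z r \ {z} = (fun w => z + Complex.exp w) '' {w : ℂ | w.re < Real.log r} := by
    ext w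
    simp only [Set.mem_sdiff, Metric.mem_ball, Set.mem_singleton_iff, Set.mem_image,
      Set.mem_ofPred_eq, dist_eq_norm]
    constructor
    · rintro ⟨h1, h2⟩
      have h0 : w - z ≠ 0 := sub_ne_zero.2 h2
      refine ⟨Complex.log (w - z), ?_, by rw [Complex.exp_log h0]; ring⟩
      rw [Complex.log_re]
      exact Real.log_lt_log (norm_pos_iff.2 h0) h1
    · rintro ⟨v, hv, rfl⟩
      refine ⟨?_, by simp⟩
      rw [add_sub_cancel_left, Complex.norm_exp, ← Real.lt_log_iff_exp_lt hr]
      exact hv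
  rw [this]
  exact (convex_halfSpace_re_lt _).isPreconnected.image _ (by fun_prop)

/-- Identity theorem along a preconnected set, for functions with isolated singularities. -/
theorem eventually_eq_of_isPreconnected {f g : ℂ → ℂ} {T : Set ℂ} (hT : IsPreconnected T)
    (hf : ∀ z ∈ T, ∀ᶠ w in nhdsWithin z {z}ᶜ, AnalyticAt ℂ f w)
    (hg : ∀ z ∈ T, ∀ᶠ w in nhdsWithin z {z}ᶜ, AnalyticAt ℂ g w)
    {z₁ z₀ : ℂ} (hz₁ : z₁ ∈ T) (hz₀ : z₀ ∈ T)
    (h : ∀ᶠ w in nhdsWithin z₁ {z₁}ᶜ, f w = g w) :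
    ∀ᶠ w in nhdsWithin z₀ {z₀}ᶜ, f w = g w := by
  let W : Set ℂ := {z | ∀ᶠ w in nhdsWithin z {z}ᶜ, f w = g w}
  have hball {P : ℂ → Prop} {z : ℂ} : (∀ᶠ w in nhdsWithin z {z}ᶜ, P w) ↔
      ∃ r > 0, ∀ w ∈ Metric.ball z r \ {z}, P w := by
    rw [Filter.Eventually, Metric.mem_nhdsWithin_iff]
    rfl
  have hsub {z : ℂ} {r : ℝ} (hr : ∀ w ∈ Metric.ball z r \ {z}, f w = g w) :
      Metric.ball z r ⊆ W := by
    intro w hw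
    by_cases hwz : w = z
    · subst hwz
      exact hball.2 ⟨r, Metric.pos_of_mem_ball hw, hr⟩
    · refine eventually_nhdsWithin_of_eventually_nhds ?_
      have : Metric.ball z r \ {z} ∈ nhds w :=
        (Metric.isOpen_ball.sdiff isClosed_singleton).mem_nhds ⟨hw, hwz⟩
      filter_upwards [this] with v hv using hr v hv
  have hW : IsOpen W := by
    rw [Metric.isOpen_iff]
    intro z hz
    obtain ⟨r, hr, hr'⟩ := hball.1 hz
    exact ⟨r, hr, hsub hr'⟩
  refine hT.subset_of_closure_inter_subset hW ⟨z₁, hz₁, h⟩ ?_ hz₀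
  rintro z ⟨hzW, hzT⟩
  obtain ⟨r, hr, hr'⟩ := hball.1 ((hf z hzT).and (hg z hzT))
  obtain ⟨w, hwW, hw⟩ := Metric.mem_closure_iff.1 hzW r hr
  by_cases hwz : w = z
  · exact hwz ▸ hwW
  · refine hball.2 ⟨r, hr, ?_⟩
    exact AnalyticOnNhd.eqOn_of_preconnected_of_frequently_eq (fun v hv => (hr' v hv).1)
      (fun v hv => (hr' v hv).2) (isPreconnected_ball_diff_singleton z r)
      ⟨by rwa [Metric.mem_ball, dist_comm], hwz⟩ (Filter.Eventually.frequently hwW)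

/-- The continuation of the double series to `1 - K / 2 < re s`, away from its poles. -/
noncomputable def contSeries (a : ℝ) (K : ℕ) (s : ℂ) : ℂ :=
  ∑ j ∈ Finset.range K, solCoeff s j * (a : ℂ) ^ (1 - 2 * s - j) * riemannZeta (2 * s + j - 1) +
    defectSum a K s

theorem differentiableAt_rpow_mul_zeta {a : ℝ} (ha : 1 ≤ a) {s : ℂ} {j : ℕ}
    (h : 2 * s + j - 1 ≠ 1) :
    DifferentiableAt ℂ
      (fun z : ℂ => (a : ℂ) ^ (1 - 2 * z - j) * riemannZeta (2 * z + j - 1)) s := by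
  have ha0 : (a : ℂ) ≠ 0 := by exact_mod_cast (by linarith : a ≠ 0)
  refine .mul (.const_cpow (by fun_prop) (.inl ha0)) ?_
  exact (differentiableAt_riemannZeta h).comp s (f := fun z : ℂ => 2 * z + j - 1) (by fun_prop)

theorem eventually_analyticAt_contSeries {a : ℝ} (ha : 1 ≤ a) {K : ℕ} {z : ℂ}
    (hz : 2 < 2 * z.re + K) :
    ∀ᶠ w in nhdsWithin z {z}ᶜ, AnalyticAt ℂ (contSeries a K) w := by
  let V : Set ℂ := {w | 2 < 2 * w.re + K} ∩ ⋂ j ∈ Finset.range K,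
    ({w : ℂ | 2 * w + j - 1 ≠ 0} ∩ {w : ℂ | 2 * w + j - 1 ≠ 1})
  have hV : IsOpen V := by
    refine (isOpen_lt (by fun_prop) (by fun_prop)).inter (isOpen_biInter_finset fun j _ => ?_)
    exact (isOpen_ne_fun (by fun_prop) (by fun_prop)).inter
      (isOpen_ne_fun (by fun_prop) (by fun_prop))
  have hne (b c : ℂ) : ∀ᶠ w : ℂ in nhdsWithin z {z}ᶜ, 2 * w + b - 1 ≠ c := by
    by_cases hzb : 2 * z + b - 1 = c
    · filter_upwards [self_mem_nhdsWithin] with w hw hwc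
      exact hw (show w = z by linear_combination (hwc - hzb) / 2)
    · exact eventually_nhdsWithin_of_eventually_nhds
        (ContinuousAt.eventually_ne (by fun_prop) hzb)
  have hzV : ∀ᶠ w in nhdsWithin z {z}ᶜ, w ∈ V := by
    have h1 : ∀ᶠ w : ℂ in nhdsWithin z {z}ᶜ, 2 < 2 * w.re + K :=
      eventually_nhdsWithin_of_eventually_nhds
        ((isOpen_lt (f := fun _ : ℂ => (2 : ℝ)) (g := fun w : ℂ => 2 * w.re + K)
          (by fun_prop) (by fun_prop)).mem_nhds hz)
    have h2 : ∀ᶠ w : ℂ in nhdsWithin z {z}ᶜ, ∀ j ∈ Finset.range K,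
        2 * w + j - 1 ≠ 0 ∧ 2 * w + j - 1 ≠ 1 :=
      (Filter.eventually_all_finset _).2 fun j _ => (hne j 0).and (hne j 1)
    filter_upwards [h1, h2] with w hw1 hw2
    exact ⟨hw1, Set.mem_iInter₂.2 hw2⟩
  filter_upwards [hzV] with w hw
  refine DifferentiableOn.analyticAt (s := V) (fun v hv => ?_) (hV.mem_nhds hw)
  have hv2 := Set.mem_iInter₂.1 hv.2
  have hreg : v ∈ regularSet K := fun n hn => .inl (hv2 n (Finset.mem_range.2 hn)).1
  refine DifferentiableAt.differentiableWithinAt (.add (.fun_sum fun j hj => ?_) ?_)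
  · simp only [mul_assoc]
    exact (differentiableAt_solCoeff j fun i hi =>
      hreg i (hi.trans_lt (Finset.mem_range.1 hj))).mul
        (differentiableAt_rpow_mul_zeta ha (hv2 j hj).2)
  · exact (differentiableOn_defectSum ha K).differentiableAt
      (((isOpen_regularSet K).inter
        (isOpen_lt (by fun_prop) (by fun_prop))).mem_nhds ⟨hreg, hv.1⟩)

theorem zero_mem_regularSet (K : ℕ) : (0 : ℂ) ∈ regularSet K := by
  intro n _
  rw [mul_zero, zero_add, or_iff_not_imp_left, not_not, sub_eq_zero]
  exact_mod_cast id

theorem truncDefect_at_zero {K : ℕ} (hK : K ≠ 0) (x : ℝ) : truncDefect K 0 x = 0 := by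
  have (y : ℝ) : truncSol K 0 y = -y := by
    rw [truncSol, Finset.sum_eq_single_of_mem 0 (Finset.mem_range.2 (Nat.pos_of_ne_zero hK))]
    · simp [solCoeff_zero]
    · intro j _ hj
      rw [solCoeff_at_zero hj, zero_mul]
  rw [truncDefect, this, this]
  push_cast
  simp
  ring

theorem tendsto_zeta_term_two {a : ℝ} (ha : 1 ≤ a) :
    Filter.Tendsto (fun s : ℂ => solCoeff s 2 *
      ((a : ℂ) ^ (1 - 2 * s - (2 : ℕ)) * riemannZeta (2 * s + (2 : ℕ) - 1)))
      (nhdsWithin 0 {0}ᶜ) (nhds (1 / (12 * a))) := by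
  have ha0 : (a : ℂ) ≠ 0 := by exact_mod_cast (by linarith : a ≠ 0)
  have hlin : Filter.Tendsto (fun s : ℂ => 2 * s + 1) (nhdsWithin 0 {0}ᶜ)
      (nhdsWithin 1 {1}ᶜ) := by
    refine tendsto_nhdsWithin_iff.2 ⟨?_, ?_⟩
    · have : ContinuousAt (fun s : ℂ => 2 * s + 1) 0 := by fun_prop
      simpa [ContinuousAt] using this.tendsto.mono_left nhdsWithin_le_nhds
    · filter_upwards [self_mem_nhdsWithin] with s hs
      simpa using hs
  have hres := riemannZeta_residue_one.comp hlin
  have hcont : ContinuousAt (fun s : ℂ => (1 / 4 - (2 * s + 1) / 12) / (2 * s + 1) / 2 *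
      (a : ℂ) ^ (-1 - 2 * s)) 0 := by
    refine .mul (.div_const (.div (by fun_prop) (by fun_prop) (by simp)) _) ?_
    exact .const_cpow (by fun_prop) (.inl ha0)
  have := (hcont.tendsto.mono_left nhdsWithin_le_nhds).mul hres
  have hval : (1 / 4 - (2 * (0 : ℂ) + 1) / 12) / (2 * 0 + 1) / 2 * (a : ℂ) ^ (-1 - 2 * (0 : ℂ)) * 1 =
      1 / (12 * a) := by
    rw [mul_zero, sub_zero, Complex.cpow_neg_one]
    field_simp
    norm_num
  rw [hval] at this
  refine this.congr' ?_
  have hne : ∀ᶠ s : ℂ in nhdsWithin 0 {0}ᶜ, 2 * s - 1 ≠ 0 :=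
    eventually_nhdsWithin_of_eventually_nhds (ContinuousAt.eventually_ne (by fun_prop) (by simp))
  filter_upwards [hne] with s hs
  rw [solCoeff_two hs]
  simp only [Function.comp, Nat.cast_ofNat]
  rw [show 1 - 2 * s - 2 = -1 - 2 * s by ring, show 2 * s + 2 - 1 = 2 * s + 1 by ring]
  ring

theorem tendsto_contSeries_zero {a : ℝ} (ha : 1 ≤ a) {K : ℕ} (hK : 3 ≤ K) :
    Filter.Tendsto (contSeries a K) (nhdsWithin 0 {0}ᶜ)
      (nhds ((a : ℂ) / 12 + 1 / (12 * (a : ℂ)))) := by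
  have hdefect : Filter.Tendsto (defectSum a K) (nhdsWithin 0 {0}ᶜ) (nhds 0) := by
    have hKr : (3 : ℝ) ≤ K := by exact_mod_cast hK
    have hmem : regularSet K ∩ {s : ℂ | 2 < 2 * s.re + K} ∈ nhds 0 :=
      ((isOpen_regularSet K).inter (isOpen_lt (by fun_prop) (by fun_prop))).mem_nhds
        ⟨zero_mem_regularSet K, by
          rw [Set.mem_ofPred_eq, Complex.zero_re]
          linarith⟩
    have h0 : defectSum a K 0 = 0 := by
      simp [defectSum, truncDefect_at_zero (by omega : K ≠ 0)]
    have := ((differentiableOn_defectSum ha K).differentiableAt hmem).continuousAt.tendsto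
    rw [h0] at this
    exact this.mono_left nhdsWithin_le_nhds
  have hterm (j : ℕ) : Filter.Tendsto (fun s : ℂ => solCoeff s j *
      ((a : ℂ) ^ (1 - 2 * s - j) * riemannZeta (2 * s + j - 1))) (nhdsWithin 0 {0}ᶜ)
      (nhds ((if j = 0 then (a : ℂ) / 12 else 0) + if j = 2 then 1 / (12 * (a : ℂ)) else 0)) := by
    rcases eq_or_ne j 2 with rfl | hj
    · simpa using tendsto_zeta_term_two ha
    · have hj' : 2 * (0 : ℂ) + j - 1 ≠ 1 := by
        intro h
        apply hj
        have : (j : ℂ) = 2 := by linear_combination h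
        exact_mod_cast this
      have h1 := (differentiableAt_solCoeff (s := 0) j fun i hi =>
        zero_mem_regularSet (j + 1) i (by omega)).mul (differentiableAt_rpow_mul_zeta ha hj')
      have h2 := h1.continuousAt.tendsto.mono_left (nhdsWithin_le_nhds (s := {0}ᶜ))
      convert! h2 using 2
      rcases eq_or_ne j 0 with rfl | hj0
      · have hz := riemannZeta_neg_nat_eq_bernoulli' 1
        norm_num [bernoulli'_two] at hz
        simp [solCoeff_zero, hz]
        ring
      · simp [hj, hj0, solCoeff_at_zero hj0]
  have hsum := (tendsto_finsetSum (Finset.range K) fun j _ => hterm j).add hdefect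
  have h0 : 0 < K := by omega
  have h2 : 2 < K := by omega
  unfold contSeries
  simpa [Finset.sum_add_distrib, h0, h2, mul_assoc] using hsum

theorem mem_regularSet_of_one_lt_re {s : ℂ} (hs : 1 < s.re) (K : ℕ) : s ∈ regularSet K := by
  refine fun n _ => .inl fun h => ?_
  have := congrArg Complex.re h
  have hn : (0 : ℝ) ≤ n := Nat.cast_nonneg n
  simp at this
  linarith

/-- for `a ≥ 1`, the double series
`Z(s) = ∑_{m,n≥1} ((am+n−1/2)² − 1/4)^{-s}` converges absolutely for `Re s > 2`, and
every analytic continuation `f` of this series to `0` satisfies `f(0) = a/12 + 1/(12a)`. -/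
theorem stmt9 (a : ℝ) (ha : 1 ≤ a) :
    (∀ s : ℂ, 2 < s.re →
      Summable (fun p : ℕ × ℕ =>
        ‖(((a : ℂ) * (p.1 + 1) + ((p.2 : ℂ) + 1) - 1 / 2) ^ 2 - 1 / 4) ^ (-s)‖)) ∧
    ∀ f : ℂ → ℂ,
      IsContinuationAt
        (fun s => ∑' (m : ℕ) (n : ℕ),
          (((a : ℂ) * (m + 1) + ((n : ℂ) + 1) - 1 / 2) ^ 2 - 1 / 4) ^ (-s)) 2 0 f →
      f 0 = (a : ℂ) / 12 + 1 / (12 * (a : ℂ)) := by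
  have hlat (m n : ℕ) : (a : ℂ) * (m + 1) + ((n : ℂ) + 1) - 1 / 2 = lat a (m, n) := by
    rw [lat]
    push_cast
    ring
  simp only [hlat]
  refine ⟨fun s hs => summable_norm_term ha (by linarith), ?_⟩
  rintro f ⟨U, hUo, hUc, h0U, hsub, hf, hfF⟩
  have h3U : (3 : ℂ) ∈ U := hsub (by simp; norm_num)
  obtain ⟨γ, hγ⟩ := (hUo.isConnected_iff_isPathConnected.1 hUc).joinedIn 0 h0U 3 h3U
  have hTU : Set.range γ ⊆ U := Set.range_subset_iff.2 hγ
  obtain ⟨B, hB⟩ := ((isCompact_range γ.continuous).image Complex.continuous_re).bddBelow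
  obtain ⟨K, hK⟩ := exists_nat_gt (max 3 (2 - 2 * B))
  have hK3 : 3 ≤ K := by exact_mod_cast ((le_max_left _ _).trans_lt hK).le
  have hKB := (le_max_right _ _).trans_lt hK
  have heq : ∀ᶠ s in nhdsWithin (3 : ℂ) {3}ᶜ, f s = contSeries a K s := by
    refine eventually_nhdsWithin_of_eventually_nhds ?_
    filter_upwards [(isOpen_lt (f := fun _ : ℂ => (2 : ℝ)) continuous_const
      Complex.continuous_re).mem_nhds (by simp; norm_num : (3 : ℂ) ∈ _)] with s hs
    rw [hfF s hs, contSeries]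
    exact tsum_term_eq ha (by linarith) (mem_regularSet_of_one_lt_re (by linarith) K)
  have hev := eventually_eq_of_isPreconnected (T := Set.range γ)
    (isPreconnected_range γ.continuous)
    (fun z hz => eventually_nhdsWithin_of_eventually_nhds
      (hf z (hTU hz)).eventually_analyticAt)
    (fun z hz => eventually_analyticAt_contSeries ha (K := K) (by
      have := hB (Set.mem_image_of_mem Complex.re hz)
      linarith))
    ⟨1, γ.target⟩ ⟨0, γ.source⟩ heq
  exact tendsto_nhds_unique ((hf 0 h0U).continuousAt.tendsto.mono_left nhdsWithin_le_nhds)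
    ((tendsto_contSeries_zero ha hK3).congr' (hev.mono fun _ h => h.symm))
end
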